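/- Let K ⊆ ℝ^d be the limit set of an irreducible finite similarity IFS satisfying the open set condition. If ν is a doubling Borel measure on ℝ^d with supp ν = K, then ν(BA) = 0. -/

import Mathlib

open MeasureTheory Filter Topology Metric
open scoped NNReal ENNReal

noncomputable section

def ContractingSimilarity {d : ℕ} (φ : EuclideanSpace ℝ (Fin d) → EuclideanSpace ℝ (Fin d)) :
    Prop :=
  ∃ c : ℝ, 0 < c ∧ c < 1 ∧ ∀ x y, dist (φ x) (φ y) = c * dist x y

def IrreducibleIFS {E : Type*} {d : ℕ}
    (φ : E → EuclideanSpace ℝ (Fin d) → EuclideanSpace ℝ (Fin d)) : Prop :=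
  ¬ ∃ L : AffineSubspace ℝ (EuclideanSpace ℝ (Fin d)),
      (L : Set (EuclideanSpace ℝ (Fin d))).Nonempty ∧ L ≠ ⊤ ∧
        ∀ e, φ e '' (L : Set (EuclideanSpace ℝ (Fin d))) = (L : Set (EuclideanSpace ℝ (Fin d)))

def OpenSetCondition {E : Type*} {d : ℕ}
    (φ : E → EuclideanSpace ℝ (Fin d) → EuclideanSpace ℝ (Fin d)) : Prop :=
  ∃ U : Set (EuclideanSpace ℝ (Fin d)), IsOpen U ∧ U.Nonempty ∧
    (∀ e, φ e '' U ⊆ U) ∧ ∀ e e', e ≠ e' → Disjoint (φ e '' U) (φ e' '' U)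

def seqApply {E X : Type*} (φ : E → X → X) (b : ℕ → E) : ℕ → X → X
  | 0 => id
  | n + 1 => fun x => seqApply φ b n (φ (b n) x)

/-- The (topological) support of a Borel measure on a metric space: the set of points all
of whose neighborhoods have positive measure. -/
def measSupport {X : Type*} [PseudoMetricSpace X] [MeasurableSpace X] (ν : Measure X) :
    Set X :=
  {x | ∀ ε : ℝ, 0 < ε → ν (ball x ε) ≠ 0}

/-- A locally finite Borel measure `ν` is doubling if there is `C ≥ 1` such that
`ν(B(x,2r)) ≤ C ν(B(x,r))` for all `x ∈ supp ν` and `0 < r ≤ 1`. -/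
def IsDoubling {X : Type*} [PseudoMetricSpace X] [MeasurableSpace X] (ν : Measure X) : Prop :=
  ∃ C : ℝ≥0, 1 ≤ C ∧ ∀ x ∈ measSupport ν, ∀ r : ℝ, 0 < r → r ≤ 1 →
    ν (ball x (2 * r)) ≤ C * ν (ball x r)

def badlyApproximable (d : ℕ) : Set (EuclideanSpace ℝ (Fin d)) :=
  {α | ∃ c : ℝ, 0 < c ∧ ∀ q : ℕ, 0 < q → ∀ p : Fin d → ℤ,
    c * (q : ℝ) ^ (-(1 : ℝ) / d) ≤
      ‖(q : ℝ) • α - (EuclideanSpace.equiv (Fin d) ℝ).symm (fun i => (p i : ℝ))‖}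

namespace BAK

set_option linter.unusedSectionVars false
section Mahler
variable {ι : Type*} [Fintype ι] [DecidableEq ι]

theorem mem_body {A : Matrix ι ι ℝ} (hA : |A.det| = 1) (c : ι → ℝ) (hc : ∀ j, 0 < c j)
    (hprod : 1 < ∏ j, c j) :
    ∃ m : ι → ℤ, m ≠ 0 ∧ ∀ j, |(A.mulVec (fun i => (m i : ℝ))) j| < c j := by
  set s : Set (ι → ℝ) := (Matrix.toLin' A) ⁻¹' (Set.pi Set.univ (fun j => Set.Ioo (-c j) (c j)))
    with hs
  have hdet : LinearMap.det (Matrix.toLin' A) = A.det := LinearMap.det_toLin' A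
  have hdet0 : LinearMap.det (Matrix.toLin' A) ≠ 0 := by
    rw [hdet]; intro h; rw [h] at hA; simp at hA
  have hvol : volume s = ENNReal.ofReal (∏ j, (2 * c j)) := by
    rw [hs, Measure.addHaar_preimage_linearMap _ hdet0, hdet, abs_inv, hA]
    simp only [inv_one, ENNReal.ofReal_one, one_mul]
    rw [volume_pi_pi]
    rw [ENNReal.ofReal_prod_of_nonneg (fun j _ => by have := hc j; positivity)]
    refine Finset.prod_congr rfl fun j _ => ?_
    rw [Real.volume_Ioo]; congr 1; ring
  have fund := ZSpan.isAddFundamentalDomain' (Pi.basisFun ℝ ι) (volume : Measure (ι → ℝ))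
  have hF : volume (ZSpan.fundamentalDomain (Pi.basisFun ℝ ι)) = 1 := by
    rw [ZSpan.fundamentalDomain_pi_basisFun, volume_pi_pi]; simp
  have hconv : Convex ℝ s := by
    apply Convex.linear_preimage
    exact convex_pi fun j _ => convex_Ioo _ _
  have hsymm : ∀ x ∈ s, -x ∈ s := by
    intro x hx
    simp only [hs, Set.mem_preimage, Set.mem_pi, Set.mem_univ, forall_true_left, map_neg,
      Pi.neg_apply, Set.mem_Ioo] at hx ⊢
    intro j
    have := hx j
    constructor <;> linarith [this.1, this.2]
  have : Countable (Submodule.span ℤ (Set.range (Pi.basisFun ℝ ι))).toAddSubgroup := by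
    change Countable (Submodule.span ℤ (Set.range (Pi.basisFun ℝ ι)))
    infer_instance
  obtain ⟨x, hx0, hxs⟩ := exists_ne_zero_mem_lattice_of_measure_mul_two_pow_lt_measure
    fund hsymm hconv (by
      rw [hF, hvol, one_mul, Module.finrank_pi, Finset.prod_mul_distrib]
      simp only [Finset.prod_const, Finset.card_univ]
      have : (2 : ℝ≥0∞) ^ Fintype.card ι = ENNReal.ofReal (2 ^ Fintype.card ι) := by
        rw [ENNReal.ofReal_pow (by norm_num)]; simp
      rw [this]
      apply (ENNReal.ofReal_lt_ofReal_iff (by positivity)).2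
      have h2 : (0:ℝ) < 2 ^ Fintype.card ι := by positivity
      nlinarith)
  have hxm : (x : ι → ℝ) ∈ Submodule.span ℤ (Set.range (Pi.basisFun ℝ ι)) := x.2
  rw [Module.Basis.mem_span_iff_repr_mem] at hxm
  choose m hm using hxm
  have hxeq : (x : ι → ℝ) = fun i => (m i : ℝ) := by
    ext i; have := hm i; simp at this; exact this.symm
  refine ⟨m, ?_, ?_⟩
  · rintro rfl
    apply hx0
    ext i
    rw [hxeq]; simp
  · intro j
    rw [hxeq] at hxs
    have := hxs j (Set.mem_univ _)
    rw [abs_lt]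
    simpa using this

/-- any hyperplane misses a bounded lattice vector -/
theorem exists_off_hyperplane (ε : ℝ) (hε : 0 < ε) :
    ∃ T : ℝ, 0 < T ∧ ∀ A : Matrix ι ι ℝ, |A.det| = 1 →
      (∀ m : ι → ℤ, m ≠ 0 → ε ≤ ‖A.mulVec (fun i => (m i : ℝ))‖) →
      ∀ l : ι → ℝ, l ≠ 0 → ∃ m : ι → ℤ, ‖A.mulVec (fun i => (m i : ℝ))‖ ≤ T ∧
        ∑ j, l j * (A.mulVec (fun i => (m i : ℝ))) j ≠ 0 := by
  set n : ℝ := Fintype.card ι + 1 with hn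
  have hnpos : 0 < n := by positivity
  set e' := ε / n with he'
  have he'pos : 0 < e' := by positivity
  set T0 := (e' ^ (Fintype.card ι - 1))⁻¹ + 1 with hT0
  have hT0pos : 0 < T0 := by positivity
  refine ⟨e' + T0, by positivity, ?_⟩
  intro A hA hsys l hl
  -- coordinate with maximal |l i|
  obtain ⟨i0, hi0⟩ : ∃ i, l i ≠ 0 := by
    by_contra h; push Not at h; exact hl (funext h)
  obtain ⟨i, -, himax⟩ := Finset.exists_max_image Finset.univ (fun j => |l j|) ⟨i0, Finset.mem_univ _⟩
  have hli : 0 < |l i| := lt_of_lt_of_le (abs_pos.2 hi0) (himax i0 (Finset.mem_univ _))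
  obtain ⟨m, hm0, hm⟩ := mem_body hA (fun j => if j = i then T0 else e')
    (fun j => by split_ifs <;> assumption) (by
      rw [Finset.prod_ite]
      simp only [Finset.prod_const]
      have h1 : (Finset.univ.filter (fun j => j = i)).card = 1 := by
        rw [Finset.card_eq_one]; exact ⟨i, by ext; simp⟩
      have h2 : (Finset.univ.filter (fun j => ¬ j = i)).card = Fintype.card ι - 1 := by
        rw [Finset.filter_not, Finset.card_sdiff_of_subset (Finset.filter_subset _ _), h1]; rfl
      rw [h1, h2, pow_one, hT0, add_mul, inv_mul_cancel₀ (by positivity)]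
      have : 0 < e' ^ (Fintype.card ι - 1) := by positivity
      linarith)
  set v := A.mulVec (fun i => (m i : ℝ)) with hv
  refine ⟨m, ?_, ?_⟩
  · rw [pi_norm_le_iff_of_nonneg (by positivity)]
    intro j
    have := hm j
    rw [Real.norm_eq_abs]
    split_ifs at this <;> linarith
  · intro hsum
    have hvn := hsys m hm0
    -- |v i| < ε
    rw [← Finset.add_sum_erase _ _ (Finset.mem_univ i)] at hsum
    have hb : |l i| * |v i| ≤ |l i| * ((Fintype.card ι : ℝ) * e') := by
      rw [← abs_mul]
      have : l i * v i = - ∑ j ∈ Finset.univ.erase i, l j * v j := by linarith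
      rw [this, abs_neg]
      refine (Finset.abs_sum_le_sum_abs _ _).trans ?_
      have : ∀ j ∈ Finset.univ.erase i, |l j * v j| ≤ |l i| * e' := by
        intro j hj
        rw [abs_mul]
        have hji : j ≠ i := Finset.ne_of_mem_erase hj
        have := hm j
        rw [if_neg hji] at this
        exact mul_le_mul (himax j (Finset.mem_univ _)) this.le (abs_nonneg _) (abs_nonneg _)
      refine (Finset.sum_le_card_nsmul _ _ _ this).trans ?_
      rw [nsmul_eq_mul]
      have : ((Finset.univ.erase i).card : ℝ) ≤ Fintype.card ι := by
        exact_mod_cast (Finset.card_erase_le).trans (by simp)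
      have h0 : 0 ≤ |l i| * e' := by positivity
      nlinarith
    have hvi : |v i| ≤ (Fintype.card ι : ℝ) * e' := le_of_mul_le_mul_left hb hli
    have hlt : (Fintype.card ι : ℝ) * e' < ε := by
      rw [he', mul_div_assoc', div_lt_iff₀ hnpos, hn]; nlinarith
    have he'lt : e' < ε := by
      have : (1:ℝ) ≤ Fintype.card ι := by
        exact_mod_cast Fintype.card_pos_iff.2 ⟨i⟩
      nlinarith
    have : ‖v‖ < ε := by
      rw [pi_norm_lt_iff hε]
      intro j
      rw [Real.norm_eq_abs]
      by_cases hji : j = i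
      · rw [hji]; linarith
      · have := hm j
        rw [if_neg hji] at this
        linarith
    linarith

theorem exists_indep (ε : ℝ) (hε : 0 < ε) :
    ∃ T : ℝ, 0 < T ∧ ∀ A : Matrix ι ι ℝ, |A.det| = 1 →
      (∀ m : ι → ℤ, m ≠ 0 → ε ≤ ‖A.mulVec (fun i => (m i : ℝ))‖) →
      ∃ q : Matrix ι ι ℤ, q.det ≠ 0 ∧ ∀ i j, |(A * q.map (Int.cast : ℤ → ℝ)) i j| ≤ T := by
  obtain ⟨T, hT, h⟩ := exists_off_hyperplane (ι := ι) ε hε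
  refine ⟨T, hT, fun A hA hsys => ?_⟩
  set S : Set (ι → ℝ) := {v | ∃ m : ι → ℤ, v = A.mulVec (fun i => (m i : ℝ)) ∧ ‖v‖ ≤ T} with hS
  have hspan : Submodule.span ℝ S = ⊤ := by
    by_contra hne
    obtain ⟨f, hf0, hf⟩ := Submodule.exists_le_ker_of_lt_top _ (lt_top_iff_ne_top.2 hne)
    obtain ⟨m, hm1, hm2⟩ := h A hA hsys (fun j => f (Pi.single j 1)) (by
      intro h0
      apply hf0
      apply LinearMap.pi_ext'
      intro j
      ext
      simpa using congrFun h0 j)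
    apply hm2
    have : f (A.mulVec (fun i => (m i : ℝ))) = 0 := by
      have := hf (Submodule.subset_span (s := S) ⟨m, rfl, hm1⟩)
      simpa using this
    rw [← this, LinearMap.pi_apply_eq_sum_univ f]
    refine Finset.sum_congr rfl fun j _ => ?_
    rw [smul_eq_mul, mul_comm]
    congr 2
    ext k; simp [Pi.single_apply, eq_comm]
  obtain ⟨b, hbS, hbspan, hbli⟩ := exists_linearIndependent ℝ S
  have hbt : ⊤ ≤ Submodule.span ℝ (Set.range (Subtype.val : b → (ι → ℝ))) := by
    rw [Subtype.range_coe, hbspan, hspan]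
  let B := Module.Basis.mk hbli hbt
  let e := B.indexEquiv (Pi.basisFun ℝ ι)
  let B' := B.reindex e
  have hB' : ∀ j, B' j ∈ S := by
    intro j
    simp only [B', B, Module.Basis.reindex_apply, Module.Basis.mk_apply]
    exact hbS (Subtype.coe_prop _)
  choose m hm1 hm2 using hB'
  refine ⟨Matrix.of fun i j => m j i, ?_, ?_⟩
  · intro h0
    have hmul : (A * (Matrix.of fun i j => m j i).map (Int.cast : ℤ → ℝ)) =
        (Pi.basisFun ℝ ι).toMatrix B' := by
      ext i j
      rw [Module.Basis.toMatrix_apply, hm1 j]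
      simp [Matrix.mul_apply, Matrix.mulVec, dotProduct]
    have hd := congrArg Matrix.det hmul
    rw [Matrix.det_mul] at hd
    have : ((Matrix.of fun i j => m j i).map (Int.cast : ℤ → ℝ)).det = 0 := by
      have := Int.cast_det (R := ℝ) (Matrix.of fun i j => m j i)
      rw [h0] at this
      simpa using this.symm
    rw [this, mul_zero] at hd
    have hu : IsUnit ((Pi.basisFun ℝ ι).toMatrix B').det := by
      rw [← Module.Basis.det_apply]
      exact Module.Basis.isUnit_det _ _
    rw [← hd] at hu
    simp at hu
  · intro i j
    have : (A * (Matrix.of fun i j => m j i).map (Int.cast : ℤ → ℝ)) i j = B' j i := by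
      rw [hm1 j]
      simp [Matrix.mul_apply, Matrix.mulVec, dotProduct]
    rw [this, ← Real.norm_eq_abs]
    exact (norm_le_pi_norm _ i).trans (hm2 j)

theorem int_factor {q q' : Matrix ι ι ℤ} {M : ℤ} (X : Matrix ι ι ℤ) (hX : q - q' = M • X)
    (hd : q'.det ∣ M) : ∃ k : Matrix ι ι ℤ, k * q' = q := by
  obtain ⟨s, hs⟩ := hd
  refine ⟨1 + s • (X * q'.adjugate), ?_⟩
  rw [add_mul, one_mul, Matrix.smul_mul, Matrix.mul_assoc, Matrix.adjugate_mul,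
    Matrix.mul_smul, Matrix.mul_one, smul_smul, mul_comm s, ← hs, ← hX]
  abel

theorem int_cancel {q a : Matrix ι ι ℤ} (hq : q.det ≠ 0) (h : a * q = q) : a = 1 := by
  have h1 : (a - 1) * q = 0 := by rw [sub_mul, h, one_mul, sub_self]
  have h2 : (a - 1) * q * q.adjugate = 0 := by rw [h1, zero_mul]
  rw [Matrix.mul_assoc, Matrix.mul_adjugate, Matrix.mul_smul, Matrix.mul_one] at h2
  have := (smul_eq_zero.1 h2).resolve_left hq
  exact sub_eq_zero.1 this

theorem mahler_matrix (ε : ℝ) (hε : 0 < ε) :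
    ∃ C : ℝ, 0 < C ∧ ∀ A : Matrix ι ι ℝ, |A.det| = 1 →
      (∀ m : ι → ℤ, m ≠ 0 → ε ≤ ‖A.mulVec (fun i => (m i : ℝ))‖) →
      ∃ k k' : Matrix ι ι ℤ, k * k' = 1 ∧
        ∀ i j, |(A * k.map (Int.cast : ℤ → ℝ)) i j| ≤ C := by
  classical
  obtain ⟨T, hT, h⟩ := exists_indep (ι := ι) ε hε
  set N : ℕ := ⌊(Nat.factorial (Fintype.card ι)) • T ^ (Fintype.card ι)⌋₊ with hN
  set M : ℕ := Nat.factorial N with hM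
  have : NeZero M := ⟨Nat.factorial_ne_zero _⟩
  set P : Matrix ι ι (ZMod M) → Matrix ι ι ℤ → Prop :=
    fun c q => q.map (Int.cast : ℤ → ZMod M) = c ∧ q.det ≠ 0 ∧ q.det.natAbs ≤ N with hP
  set rep : Matrix ι ι (ZMod M) → Matrix ι ι ℤ :=
    fun c => if hc : ∃ q, P c q then hc.choose else 1 with hrep
  have hrepP : ∀ c q, P c q → P c (rep c) := by
    intro c q hq
    have hc : ∃ q, P c q := ⟨q, hq⟩
    simp only [hrep, dif_pos hc]
    exact hc.choose_spec
  obtain ⟨C0, hC0⟩ : ∃ C0 : ℝ, ∀ (x : Matrix ι ι (ZMod M) × ι × ι),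
      |(((rep x.1).adjugate x.2.1 x.2.2 : ℤ) : ℝ)| ≤ C0 := by
    obtain ⟨C0, hC0⟩ := (Set.finite_range fun x : Matrix ι ι (ZMod M) × ι × ι =>
      |(((rep x.1).adjugate x.2.1 x.2.2 : ℤ) : ℝ)|).bddAbove
    exact ⟨C0, fun x => hC0 ⟨x, rfl⟩⟩
  refine ⟨(Fintype.card ι : ℝ) * (T * |C0|) + 1, by positivity, fun A hA hsys => ?_⟩
  obtain ⟨q, hq0, hqT⟩ := h A hA hsys
  have hcast : ∀ p : Matrix ι ι ℤ, ((p.det : ℤ) : ℝ) = (p.map (Int.cast : ℤ → ℝ)).det :=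
    fun p => Int.cast_det (R := ℝ) p
  have hqN : q.det.natAbs ≤ N := by
    rw [hN]
    apply Nat.le_floor
    have h1 := Matrix.det_le (A := A * q.map (Int.cast : ℤ → ℝ)) (abv := IsAbsoluteValue.toAbsoluteValue (abs : ℝ → ℝ)) (x := T) hqT
    have h2 : |(A * q.map (Int.cast : ℤ → ℝ)).det| = ((q.det.natAbs : ℕ) : ℝ) := by
      rw [Matrix.det_mul, abs_mul, hA, one_mul, ← hcast, Nat.cast_natAbs, Int.cast_abs]
    rw [← h2]; exact h1
  set q' := rep (q.map (Int.cast : ℤ → ZMod M)) with hq'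
  obtain ⟨hc, hq'0, hq'N⟩ : P (q.map (Int.cast : ℤ → ZMod M)) q' :=
    hrepP _ q ⟨rfl, hq0, hqN⟩
  have hdvd : ∀ p : Matrix ι ι ℤ, p.det ≠ 0 → p.det.natAbs ≤ N → p.det ∣ (M : ℤ) := by
    intro p h0 hp
    rw [← Int.natAbs_dvd, Int.natCast_dvd_natCast, hM]
    exact Nat.dvd_factorial (Int.natAbs_pos.2 h0) hp
  have hXex : ∀ i j, ∃ x : ℤ, q i j - q' i j = (M : ℤ) * x := by
    intro i j
    have := congrFun (congrFun hc i) j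
    simp only [Matrix.map_apply] at this
    have h3 := (ZMod.intCast_eq_intCast_iff_dvd_sub _ _ _).1 this
    exact h3
  choose X hX using hXex
  obtain ⟨k, hk⟩ := int_factor (q := q) (q' := q') (M := M) (Matrix.of X)
    (by ext i j; simp [hX]) (hdvd _ hq'0 hq'N)
  obtain ⟨k', hk'⟩ := int_factor (q := q') (q' := q) (M := M) (Matrix.of fun i j => - X i j)
    (by ext i j; have := hX i j; simp; linarith) (hdvd _ hq0 hqN)
  refine ⟨k, k', int_cancel hq0 (by rw [Matrix.mul_assoc, hk', hk]), fun i j => ?_⟩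
  have hw : (A * k.map (Int.cast : ℤ → ℝ)) * q'.map (Int.cast : ℤ → ℝ)
      = A * q.map (Int.cast : ℤ → ℝ) := by
    rw [Matrix.mul_assoc, ← hk]
    congr 1
    exact (Matrix.map_mul (f := Int.castRingHom ℝ)).symm
  have hadj : q'.map (Int.cast : ℤ → ℝ) * q'.adjugate.map (Int.cast : ℤ → ℝ)
      = (q'.det : ℝ) • (1 : Matrix ι ι ℝ) := by
    have h1 := (Matrix.map_mul (L := q') (M := q'.adjugate) (f := Int.castRingHom ℝ)).symm
    rw [Matrix.mul_adjugate] at h1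
    refine h1.trans ?_
    ext i j
    simp only [Matrix.map_apply, Matrix.smul_apply, Matrix.one_apply, smul_eq_mul]
    split_ifs <;> simp
  have hw2 : (q'.det : ℝ) • (A * k.map (Int.cast : ℤ → ℝ))
      = (A * q.map (Int.cast : ℤ → ℝ)) * q'.adjugate.map (Int.cast : ℤ → ℝ) := by
    rw [← hw, Matrix.mul_assoc, hadj, Matrix.mul_smul, Matrix.mul_one]
  have hentry := congrFun (congrFun hw2 i) j
  rw [Matrix.smul_apply, smul_eq_mul] at hentry
  have h1 : (1 : ℝ) ≤ |(q'.det : ℝ)| := by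
    rw [← Int.cast_abs]; exact_mod_cast Int.one_le_abs hq'0
  have h2 : |(A * k.map (Int.cast : ℤ → ℝ)) i j| ≤
      |(q'.det : ℝ)| * |(A * k.map (Int.cast : ℤ → ℝ)) i j| :=
    le_mul_of_one_le_left (abs_nonneg _) h1
  rw [← abs_mul, hentry] at h2
  refine h2.trans ?_
  rw [Matrix.mul_apply]
  refine (Finset.abs_sum_le_sum_abs _ _).trans ?_
  have h3 : ∀ l ∈ Finset.univ, |(A * q.map (Int.cast : ℤ → ℝ)) i l *
      q'.adjugate.map (Int.cast : ℤ → ℝ) l j| ≤ T * |C0| := by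
    intro l _
    rw [abs_mul]
    exact mul_le_mul (hqT i l) ((hC0 (_, l, j)).trans (le_abs_self _)) (abs_nonneg _) hT.le
  refine (Finset.sum_le_card_nsmul _ _ _ h3).trans ?_
  rw [nsmul_eq_mul, Finset.card_univ]
  linarith

variable {V : Type*} [NormedAddCommGroup V] [NormedSpace ℝ V]

theorem mem_Zb (b : Module.Basis ι ℝ V) (v : V) :
    v ∈ Submodule.span ℤ (Set.range b) ↔ ∃ m : ι → ℤ, b.equivFun v = fun i => (m i : ℝ) := by
  rw [Module.Basis.mem_span_iff_repr_mem]
  constructor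
  · intro h
    choose m hm using h
    exact ⟨m, by ext i; simpa using (hm i).symm⟩
  · rintro ⟨m, hm⟩ i
    exact ⟨m i, by simpa using (congrFun hm i).symm⟩

theorem toLin_int_mem (b : Module.Basis ι ℝ V) (k : Matrix ι ι ℤ) (v : V)
    (hv : v ∈ Submodule.span ℤ (Set.range b)) :
    Matrix.toLin b b (k.map (Int.cast : ℤ → ℝ)) v ∈ Submodule.span ℤ (Set.range b) := by
  rw [mem_Zb] at hv ⊢
  obtain ⟨m, hm⟩ := hv
  refine ⟨k.mulVec m, ?_⟩
  have := Matrix.repr_toLin b b (k.map (Int.cast : ℤ → ℝ)) v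
  ext i
  simp only [Module.Basis.equivFun_apply] at hm ⊢
  rw [this, hm]
  simp [Matrix.mulVec, dotProduct]

theorem mahler [FiniteDimensional ℝ V] (b : Module.Basis ι ℝ V) (ε : ℝ) (hε : 0 < ε) :
    ∃ C : ℝ, 0 < C ∧ ∀ g : V →L[ℝ] V, |g.det| = 1 →
      (∀ m ∈ Submodule.span ℤ (Set.range b), m ≠ 0 → ε ≤ ‖g m‖) →
      ∃ g' : V →L[ℝ] V, |g'.det| = 1 ∧ ‖g'‖ ≤ C ∧
        g' '' (Submodule.span ℤ (Set.range b) : Set V)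
          = g '' (Submodule.span ℤ (Set.range b) : Set V) := by
  set e := b.equivFunL with he
  set c1 := ‖(e.symm : (ι → ℝ) →L[ℝ] V)‖ with hc1
  set c2 := ‖(e : V →L[ℝ] (ι → ℝ))‖ with hc2
  obtain ⟨C, hC, h⟩ := mahler_matrix (ι := ι) (ε / (c1 + 1)) (by positivity)
  refine ⟨c1 * (Fintype.card ι * C * c2) + 1, by positivity, fun g hg hsys => ?_⟩
  set A := LinearMap.toMatrix b b (g : V →ₗ[ℝ] V) with hAdef
  have hA : |A.det| = 1 := by rw [hAdef, LinearMap.det_toMatrix]; exact hg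
  have heA : ∀ v, e (g v) = A.mulVec (e v) := by
    intro v
    exact (LinearMap.toMatrix_mulVec_repr b b (g : V →ₗ[ℝ] V) v).symm
  obtain ⟨k, k', hkk, hbd⟩ := h A hA (by
    intro m hm0
    set v := e.symm (fun i => (m i : ℝ)) with hv
    have hev : e v = fun i => (m i : ℝ) := by simp [hv]
    have h1 := hsys v ((mem_Zb b v).2 ⟨m, hev⟩) (by
      intro h0
      rw [h0, map_zero] at hev
      apply hm0; ext i
      have := congrFun hev i
      simp only [Pi.zero_apply] at this
      exact_mod_cast this.symm)
    rw [← hev, ← heA]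
    have h2 : ‖g v‖ ≤ c1 * ‖e (g v)‖ := by
      have := (e.symm : (ι → ℝ) →L[ℝ] V).le_opNorm (e (g v))
      simpa using this
    rw [div_le_iff₀ (by positivity)]
    nlinarith [norm_nonneg (e (g v))])
  have hk'k : k' * k = 1 := mul_eq_one_comm.1 hkk
  set κ : V →L[ℝ] V := LinearMap.toContinuousLinearMap
    (Matrix.toLin b b (k.map (Int.cast : ℤ → ℝ))) with hκ
  have hdetk : |(k.map (Int.cast : ℤ → ℝ)).det| = 1 := by
    have h1 : ((k.det : ℤ) : ℝ) = (k.map (Int.cast : ℤ → ℝ)).det := Int.cast_det (R := ℝ) k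
    rw [← h1, ← Int.cast_abs]
    have : IsUnit k.det := by
      have := congrArg Matrix.det hkk
      rw [Matrix.det_mul, Matrix.det_one] at this
      exact IsUnit.of_mul_eq_one _ this
    rw [Int.isUnit_iff_abs_eq.1 this]; simp
  refine ⟨g.comp κ, ?_, ?_, ?_⟩
  · have : (g.comp κ).det = g.det * κ.det := by
      simp only [ContinuousLinearMap.det]
      rw [← LinearMap.det_comp]; rfl
    rw [this, abs_mul, hg, one_mul]
    have : κ.det = (k.map (Int.cast : ℤ → ℝ)).det := by
      rw [← LinearMap.det_toLin b]; rfl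
    rw [this, hdetk]
  · refine ContinuousLinearMap.opNorm_le_bound _ (by positivity) fun v => ?_
    have h1 : e ((g.comp κ) v) = (A * k.map (Int.cast : ℤ → ℝ)).mulVec (e v) := by
      rw [← Matrix.mulVec_mulVec, ContinuousLinearMap.comp_apply, heA]
      congr 1
      exact Matrix.repr_toLin b b (k.map (Int.cast : ℤ → ℝ)) v
    have h2 : ‖(g.comp κ) v‖ ≤ c1 * ‖e ((g.comp κ) v)‖ := by
      have := (e.symm : (ι → ℝ) →L[ℝ] V).le_opNorm (e ((g.comp κ) v))
      simpa using this
    have h3 : ‖e v‖ ≤ c2 * ‖v‖ := (e : V →L[ℝ] (ι → ℝ)).le_opNorm v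
    have h4 : ‖e ((g.comp κ) v)‖ ≤ Fintype.card ι * C * ‖e v‖ := by
      rw [h1, pi_norm_le_iff_of_nonneg (by positivity)]
      intro i
      rw [Real.norm_eq_abs]
      refine (Finset.abs_sum_le_sum_abs _ _).trans ?_
      have h5 : ∀ j ∈ Finset.univ, |(A * k.map (Int.cast : ℤ → ℝ)) i j * (e v) j|
          ≤ C * ‖e v‖ := by
        intro j _
        rw [abs_mul]
        exact mul_le_mul (hbd i j) (norm_le_pi_norm (e v) j) (abs_nonneg _) hC.le
      refine (Finset.sum_le_card_nsmul _ _ _ h5).trans ?_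
      rw [nsmul_eq_mul, Finset.card_univ]
      linarith
    have h6 : (0:ℝ) ≤ Fintype.card ι * C := by positivity
    calc ‖(g.comp κ) v‖ ≤ c1 * (Fintype.card ι * C * (c2 * ‖v‖)) := by
          refine h2.trans ?_
          gcongr
          exact h4.trans (by gcongr)
      _ ≤ _ := by nlinarith [norm_nonneg v]
  · ext w
    constructor
    · rintro ⟨v, hv, rfl⟩
      exact ⟨κ v, toLin_int_mem b k v hv, rfl⟩
    · rintro ⟨v, hv, rfl⟩
      refine ⟨_, toLin_int_mem b k' v hv, ?_⟩
      have : κ (Matrix.toLin b b (k'.map (Int.cast : ℤ → ℝ)) v) = v := by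
        change Matrix.toLin b b (k.map (Int.cast : ℤ → ℝ))
          (Matrix.toLin b b (k'.map (Int.cast : ℤ → ℝ)) v) = v
        rw [← Matrix.toLin_mul_apply]
        have h1 : k.map (Int.cast : ℤ → ℝ) * k'.map (Int.cast : ℤ → ℝ) = 1 := by
          have := (Matrix.map_mul (L := k) (M := k') (f := Int.castRingHom ℝ)).symm
          rw [hkk] at this
          refine this.trans ?_
          ext i j; simp [Matrix.one_apply]
        rw [h1, Matrix.toLin_one]; rfl
      simp only [ContinuousLinearMap.comp_apply, this]
end Mahler
end BAK

namespace BAK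

abbrev EE (d : ℕ) := EuclideanSpace ℝ (Fin d)
abbrev WW (d : ℕ) := EE d × ℝ

variable {d : ℕ}

def bW (d : ℕ) : Module.Basis (Fin d ⊕ Unit) ℝ (WW d) :=
  ((EuclideanSpace.basisFun (Fin d) ℝ).toBasis).prod (Module.Basis.singleton Unit ℝ)

def ZZ (d : ℕ) : Submodule ℤ (WW d) := Submodule.span ℤ (Set.range (bW d))

theorem mem_ZZ (w : WW d) : w ∈ ZZ d ↔ (∃ p : Fin d → ℤ, ∀ i, w.1 i = p i) ∧ ∃ q : ℤ, w.2 = q := by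
  rw [ZZ, mem_Zb]
  constructor
  · rintro ⟨m, hm⟩
    refine ⟨⟨fun i => m (Sum.inl i), fun i => ?_⟩, m (Sum.inr ()), ?_⟩
    · have := congrFun hm (Sum.inl i); simpa [bW] using this
    · have := congrFun hm (Sum.inr ()); simpa [bW] using this
  · rintro ⟨⟨p, hp⟩, q, hq⟩
    refine ⟨Sum.elim p (fun _ => q), ?_⟩
    ext i
    rcases i with i | i
    · simpa [bW] using hp i
    · simpa [bW] using hq

/-- shear -/
def sh (t : EE d) : WW d →L[ℝ] WW d :=
  (ContinuousLinearMap.fst ℝ (EE d) ℝ - (ContinuousLinearMap.snd ℝ (EE d) ℝ).smulRight t).prod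
    (ContinuousLinearMap.snd ℝ (EE d) ℝ)

@[simp] theorem sh_apply (t : EE d) (w : WW d) : sh t w = (w.1 - w.2 • t, w.2) := rfl

theorem sh_det (t : EE d) : (sh t).det = 1 := by
  have : ((sh t : WW d →L[ℝ] WW d) : WW d →ₗ[ℝ] WW d)
      = LinearMap.transvection (LinearMap.snd ℝ (EE d) ℝ) (-t, 0) := by
    ext x <;> simp [LinearMap.transvection.apply]
  rw [ContinuousLinearMap.det, this, LinearMap.transvection.det]
  simp

/-- similarity of ratio `r` -/
def IsSim (S : EE d →L[ℝ] EE d) (r : ℝ) : Prop := 0 < r ∧ ∀ x, ‖S x‖ = r * ‖x‖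

theorem IsSim.comp {S T : EE d →L[ℝ] EE d} {r s : ℝ} (hS : IsSim S r) (hT : IsSim T s) :
    IsSim (S.comp T) (r * s) :=
  ⟨mul_pos hS.1 hT.1, fun x => by
    rw [ContinuousLinearMap.comp_apply, hS.2, hT.2, mul_assoc]⟩

theorem IsSim.smul {S : EE d →L[ℝ] EE d} {r : ℝ} (hS : IsSim S r) {c : ℝ} (hc : 0 < c) :
    IsSim (c • S) (c * r) :=
  ⟨mul_pos hc hS.1, fun x => by
    rw [smul_apply, norm_smul, hS.2, Real.norm_of_nonneg hc.le, mul_assoc]⟩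

theorem isSim_one : IsSim (ContinuousLinearMap.id ℝ (EE d)) 1 := ⟨one_pos, fun x => by simp⟩

theorem IsSim.pow {S : EE d →L[ℝ] EE d} {r : ℝ} (hS : IsSim S r) (n : ℕ) :
    IsSim (S ^ n) (r ^ n) := by
  induction n with
  | zero => rw [pow_zero, pow_zero]; exact isSim_one
  | succ n ih => rw [pow_succ, pow_succ]; exact ih.comp hS

theorem IsSim.norm_le {S : EE d →L[ℝ] EE d} {r : ℝ} (hS : IsSim S r) : ‖S‖ ≤ r :=
  ContinuousLinearMap.opNorm_le_bound _ hS.1.le fun x => (hS.2 x).le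

theorem IsSim.exists_inv {S : EE d →L[ℝ] EE d} {r : ℝ} (hS : IsSim S r) :
    ∃ S' : EE d →L[ℝ] EE d, IsSim S' r⁻¹ ∧ (∀ x, S (S' x) = x) ∧ ∀ x, S' (S x) = x := by
  have hinj : Function.Injective (S : EE d →ₗ[ℝ] EE d) := by
    rw [injective_iff_map_eq_zero]
    intro x hx
    have := hS.2 x
    have hx' : S x = 0 := hx
    rw [hx', norm_zero] at this
    have h2 := (mul_eq_zero.1 this.symm).resolve_left hS.1.ne'
    exact norm_eq_zero.1 h2
  set e := LinearEquiv.ofInjectiveEndo (S : EE d →ₗ[ℝ] EE d) hinj with he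
  have h1 : ∀ x, S (e.symm x) = x := fun x => by
    have := e.apply_symm_apply x
    exact this
  have h2 : ∀ x, e.symm (S x) = x := fun x => by
    have := e.symm_apply_apply x
    exact this
  refine ⟨LinearMap.toContinuousLinearMap (e.symm : EE d →ₗ[ℝ] EE d),
    ⟨inv_pos.2 hS.1, fun x => ?_⟩, h1, h2⟩
  have := hS.2 (e.symm x)
  rw [h1] at this
  rw [this, ← mul_assoc, inv_mul_cancel₀ hS.1.ne', one_mul]
  rfl

theorem IsSim.abs_det {S : EE d →L[ℝ] EE d} {r : ℝ} (hS : IsSim S r) : |S.det| = r ^ d := by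
  let O : EE d →ₗᵢ[ℝ] EE d := ⟨(r⁻¹ • S : EE d →L[ℝ] EE d).toLinearMap, fun x => by
    have := (hS.smul (inv_pos.2 hS.1)).2 x
    rw [inv_mul_cancel₀ hS.1.ne', one_mul] at this
    exact this⟩
  have h1 := O.normDet_eq_one
  rw [LinearMap.normDet_eq_abs_det] at h1
  have h2 : O.toLinearMap = r⁻¹ • (S : EE d →ₗ[ℝ] EE d) := rfl
  rw [h2, LinearMap.det_smul, abs_mul, abs_pow, abs_of_pos (inv_pos.2 hS.1)] at h1
  simp only [finrank_euclideanSpace, Fintype.card_fin] at h1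
  rw [ContinuousLinearMap.det]
  rw [inv_pow] at h1
  have := pow_pos hS.1 d
  field_simp at h1
  exact h1

def kap (d : ℕ) (r : ℝ) : ℝ := r ^ (-(d / (d + 1) : ℝ))

theorem kap_pos {r : ℝ} (hr : 0 < r) : 0 < kap d r := Real.rpow_pos_of_pos hr _

theorem kap_pow {r : ℝ} (hr : 0 < r) : kap d r ^ (d + 1) * r ^ d = 1 := by
  rw [kap, ← Real.rpow_natCast, ← Real.rpow_mul hr.le, ← Real.rpow_natCast, ← Real.rpow_add hr]
  have : (-(d / (d + 1) : ℝ)) * ((d + 1 : ℕ) : ℝ) + (d : ℝ) = 0 := by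
    push_cast
    have : (d + 1 : ℝ) ≠ 0 := by positivity
    field_simp
    ring
  rw [this, Real.rpow_zero]

/-- lift of a similarity -/
def HH (S : EE d →L[ℝ] EE d) (r : ℝ) : WW d →L[ℝ] WW d :=
  kap d r • (S.prodMap (ContinuousLinearMap.id ℝ ℝ))

@[simp] theorem HH_apply (S : EE d →L[ℝ] EE d) (r : ℝ) (w : WW d) :
    HH S r w = (kap d r • S w.1, kap d r * w.2) := rfl

theorem HH_det {S : EE d →L[ℝ] EE d} {r : ℝ} (hS : IsSim S r) : |(HH S r).det| = 1 := by
  have : ((HH S r : WW d →L[ℝ] WW d) : WW d →ₗ[ℝ] WW d)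
      = kap d r • (LinearMap.prodMap (S : EE d →ₗ[ℝ] EE d) LinearMap.id) := rfl
  rw [ContinuousLinearMap.det, this, LinearMap.det_smul, LinearMap.det_prodMap, LinearMap.det_id,
    mul_one, abs_mul]
  have h2 : |LinearMap.det (S : EE d →ₗ[ℝ] EE d)| = r ^ d := hS.abs_det
  rw [h2, abs_pow, abs_of_pos (kap_pos hS.1)]
  have : Module.finrank ℝ (WW d) = d + 1 := by simp
  rw [this, kap_pow hS.1]

/-- the norm form -/
def NN (w : WW d) : ℝ := ‖w.1‖ ^ d * |w.2|

theorem NN_HH {S : EE d →L[ℝ] EE d} {r : ℝ} (hS : IsSim S r) (w : WW d) :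
    NN (HH S r w) = NN w := by
  simp only [NN, HH_apply, norm_smul, hS.2, abs_mul, Real.norm_of_nonneg (kap_pos hS.1).le,
    abs_of_pos (kap_pos hS.1), mul_pow]
  calc _ = (kap d r ^ (d + 1) * r ^ d) * (‖w.1‖ ^ d * |w.2|) := by ring
    _ = _ := by rw [kap_pow hS.1, one_mul]

theorem continuous_NN : Continuous (NN : WW d → ℝ) := by
  unfold NN; fun_prop

def Good (ε : ℝ) (Λ : Set (WW d)) (x : EE d) : Prop :=
  ∀ w ∈ Λ, w ≠ 0 → ε ≤ NN (sh x w)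

theorem good_sh {ε : ℝ} {Λ : Set (WW d)} (t x : EE d) :
    Good ε (sh t '' Λ) x ↔ Good ε Λ (x + t) := by
  have key : ∀ w : WW d, sh x (sh t w) = sh (x + t) w := by
    intro w; simp only [sh_apply, smul_add, Prod.mk.injEq, and_true]; abel
  have hz : ∀ w : WW d, sh t w = 0 ↔ w = 0 := by
    intro w
    constructor
    · intro h
      have h2 : w.2 = 0 := congrArg Prod.snd h
      have h1 : w.1 - w.2 • t = 0 := congrArg Prod.fst h
      rw [h2, zero_smul, sub_zero] at h1
      exact Prod.ext h1 h2
    · rintro rfl; simp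
  constructor
  · intro h w hw hw0
    rw [← key]
    exact h _ ⟨w, hw, rfl⟩ (fun h0 => hw0 ((hz w).1 h0))
  · rintro h _ ⟨w, hw, rfl⟩ hw0
    rw [key]
    exact h w hw (fun h0 => hw0 ((hz w).2 h0))

theorem good_HH {ε : ℝ} {Λ : Set (WW d)} {S : EE d →L[ℝ] EE d} {r : ℝ} (hS : IsSim S r)
    {x : EE d} (h : Good ε Λ x) : Good ε (HH S r '' Λ) (S x) := by
  rintro _ ⟨w, hw, rfl⟩ hw0
  have : sh (S x) (HH S r w) = HH S r (sh x w) := by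
    simp only [sh_apply, HH_apply, map_sub, map_smul, smul_sub, smul_smul]
  rw [this, NN_HH hS]
  exact h w hw (fun h0 => hw0 (by rw [h0, map_zero]))

theorem Good.norm_ge {ε : ℝ} (_hε : 0 < ε) {Λ : Set (WW d)} (h : Good ε Λ 0) :
    ∀ w ∈ Λ, w ≠ 0 → min ε 1 ≤ ‖w‖ := by
  intro w hw hw0
  have h1 := h w hw hw0
  simp only [sh_apply, smul_zero, sub_zero, NN] at h1
  by_contra hlt
  push Not at hlt
  have h2 : ‖w‖ < 1 := hlt.trans_le (min_le_right _ _)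
  have h3 : ‖w‖ < ε := hlt.trans_le (min_le_left _ _)
  have ha : ‖w.1‖ ≤ ‖w‖ := norm_fst_le w
  have hb : |w.2| ≤ ‖w‖ := norm_snd_le w
  have h4 : ‖w.1‖ ^ d ≤ 1 := pow_le_one₀ (norm_nonneg _) (ha.trans h2.le)
  nlinarith [abs_nonneg w.2]

theorem Good.snd_ne {ε : ℝ} (hε : 0 < ε) {Λ : Set (WW d)} {x : EE d} (h : Good ε Λ x) :
    ∀ w ∈ Λ, w.2 = 0 → w = 0 := by
  intro w hw h0
  by_contra hne
  have := h w hw hne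
  simp only [sh_apply, NN, h0, abs_zero, mul_zero] at this
  linarith

def IsLat (Λ : Set (WW d)) : Prop :=
  ∃ g : WW d →L[ℝ] WW d, |g.det| = 1 ∧ Λ = g '' (ZZ d : Set (WW d))

theorem det_comp (f g : WW d →L[ℝ] WW d) : (f.comp g).det = f.det * g.det := by
  simp only [ContinuousLinearMap.det]
  rw [← LinearMap.det_comp]; rfl

theorem IsLat.image {Λ : Set (WW d)} (h : IsLat Λ) {f : WW d →L[ℝ] WW d} (hf : |f.det| = 1) :
    IsLat (f '' Λ) := by
  obtain ⟨g, hg, rfl⟩ := h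
  refine ⟨f.comp g, by rw [det_comp, abs_mul, hf, hg, one_mul], ?_⟩
  rw [Set.image_image]; rfl

theorem IsLat.sh {Λ : Set (WW d)} (h : IsLat Λ) (t : EE d) : IsLat (sh t '' Λ) :=
  h.image (by rw [sh_det, abs_one])

theorem IsLat.sub_mem {Λ : Set (WW d)} (h : IsLat Λ) {v w : WW d} (hv : v ∈ Λ) (hw : w ∈ Λ) :
    v - w ∈ Λ := by
  obtain ⟨g, hg, rfl⟩ := h
  obtain ⟨a, ha, rfl⟩ := hv
  obtain ⟨b, hb, rfl⟩ := hw
  exact ⟨a - b, (ZZ d).sub_mem ha hb, map_sub _ _ _⟩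

theorem mahlerW (ε : ℝ) (hε : 0 < ε) :
    ∃ C : ℝ, 0 < C ∧ ∀ Λ : Set (WW d), IsLat Λ → (∀ w ∈ Λ, w ≠ 0 → ε ≤ ‖w‖) →
      ∃ g : WW d →L[ℝ] WW d, |g.det| = 1 ∧ ‖g‖ ≤ C ∧ Λ = g '' (ZZ d : Set (WW d)) := by
  obtain ⟨C, hC, h⟩ := mahler (bW d) ε hε
  refine ⟨C, hC, ?_⟩
  rintro Λ ⟨g, hg, rfl⟩ hsys
  obtain ⟨g', h1, h2, h3⟩ := h g hg (fun m hm hm0 => hsys (g m) ⟨m, hm, rfl⟩ (by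
    intro h0
    have hinj : Function.Injective (g : WW d →ₗ[ℝ] WW d) := by
      have : LinearMap.det (g : WW d →ₗ[ℝ] WW d) ≠ 0 := by
        intro h; rw [ContinuousLinearMap.det, h] at hg; simp at hg
      exact (LinearMap.equivOfDetNeZero _ this).injective
    exact hm0 (hinj (h0.trans (map_zero g).symm))))
  exact ⟨g', h1, h2, h3.symm⟩

theorem good_limit {ε : ℝ} {g : ℕ → (WW d →L[ℝ] WW d)} {g' : WW d →L[ℝ] WW d}
    {x : ℕ → EE d} {x' : EE d} (hg : Tendsto g atTop (𝓝 g')) (hx : Tendsto x atTop (𝓝 x'))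
    (h : ∀ᶠ k in atTop, Good ε (g k '' (ZZ d : Set (WW d))) (x k)) :
    Good ε (g' '' (ZZ d : Set (WW d))) x' := by
  rintro _ ⟨m, hm, rfl⟩ hne
  have h1 : Tendsto (fun k => g k m) atTop (𝓝 (g' m)) :=
    ((ContinuousLinearMap.apply ℝ (WW d) m).continuous.tendsto g').comp hg
  have h2 : ∀ᶠ k in atTop, g k m ≠ 0 := h1.eventually_ne hne
  have h3 : Tendsto (fun k => NN (sh (x k) (g k m))) atTop (𝓝 (NN (sh x' (g' m)))) := by
    apply (continuous_NN.tendsto _).comp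
    simp only [sh_apply]
    have ha := (continuous_fst.tendsto _).comp h1
    have hb := (continuous_snd.tendsto _).comp h1
    exact (ha.sub (hb.smul hx)).prodMk_nhds hb
  refine ge_of_tendsto h3 ?_
  filter_upwards [h, h2] with k hk hk2
  exact hk _ ⟨m, hm, rfl⟩ hk2

/-- a sequence of lattices and similarities has a convergent subsequence -/
theorem extract {ε : ℝ} (hε : 0 < ε) {Λ : ℕ → Set (WW d)} (hΛ : ∀ k, IsLat (Λ k))
    (hgood : ∀ k, Good ε (Λ k) 0) :
    ∃ (ψ : ℕ → ℕ) (g : ℕ → (WW d →L[ℝ] WW d)) (g' : WW d →L[ℝ] WW d), StrictMono ψ ∧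
      (∀ k, |(g k).det| = 1) ∧ |g'.det| = 1 ∧
      (∀ k, Λ (ψ k) = g k '' (ZZ d : Set (WW d))) ∧ Tendsto g atTop (𝓝 g') := by
  obtain ⟨C, hC, h⟩ := mahlerW (d := d) (min ε 1) (lt_min hε one_pos)
  choose g hg1 hg2 hg3 using fun k => h (Λ k) (hΛ k) ((hgood k).norm_ge hε)
  obtain ⟨g', -, ψ, hψ, hlim⟩ := (isCompact_closedBall (0 : WW d →L[ℝ] WW d) C).tendsto_subseq
    (x := g) (fun k => by simpa using hg2 k)
  refine ⟨ψ, g ∘ ψ, g', hψ, fun k => hg1 _, ?_, fun k => hg3 _, hlim⟩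
  have hcont : Continuous fun f : WW d →L[ℝ] WW d => |f.det| :=
    ContinuousLinearMap.continuous_det.abs
  have h1 := (hcont.tendsto g').comp hlim
  have h2 : ((fun f : WW d →L[ℝ] WW d => |f.det|) ∘ (g ∘ ψ)) = fun _ => (1 : ℝ) := by
    ext k; simp [hg1]
  rw [h2] at h1
  exact (tendsto_nhds_unique h1 tendsto_const_nhds)

theorem extract_sim {S : ℕ → (EE d →L[ℝ] EE d)} {r : ℕ → ℝ} {a b : ℝ} (ha : 0 < a)
    (hS : ∀ k, IsSim (S k) (r k)) (hr : ∀ k, r k ∈ Set.Icc a b) :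
    ∃ (ψ : ℕ → ℕ) (S' : EE d →L[ℝ] EE d) (r' : ℝ), StrictMono ψ ∧ r' ∈ Set.Icc a b ∧
      IsSim S' r' ∧ Tendsto (S ∘ ψ) atTop (𝓝 S') := by
  obtain ⟨⟨S', r'⟩, hmem, ψ, hψ, hlim⟩ := ((isCompact_closedBall (0 : EE d →L[ℝ] EE d) b).prod
    (isCompact_Icc (a := a) (b := b))).tendsto_subseq (x := fun k => (S k, r k))
    (fun k => ⟨by simpa using (hS k).norm_le.trans (hr k).2, hr k⟩)
  have h1 : Tendsto (S ∘ ψ) atTop (𝓝 S') := (continuous_fst.tendsto _).comp hlim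
  have h2 : Tendsto (r ∘ ψ) atTop (𝓝 r') := (continuous_snd.tendsto _).comp hlim
  refine ⟨ψ, S', r', hψ, hmem.2, ⟨ha.trans_le hmem.2.1, fun x => ?_⟩, h1⟩
  have h3 : Tendsto (fun k => ‖S (ψ k) x‖) atTop (𝓝 ‖S' x‖) :=
    (((ContinuousLinearMap.apply ℝ (EE d) x).continuous.tendsto S').comp h1).norm
  have h4 : Tendsto (fun k => r (ψ k) * ‖x‖) atTop (𝓝 (r' * ‖x‖)) := h2.mul_const _
  refine tendsto_nhds_unique h3 (h4.congr fun k => ((hS _).2 x).symm)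
end BAK

namespace BAK
variable {d : ℕ}

abbrev idW (d : ℕ) : WW d →L[ℝ] WW d := ContinuousLinearMap.id ℝ (WW d)
abbrev idE (d : ℕ) : EE d →L[ℝ] EE d := ContinuousLinearMap.id ℝ (EE d)

theorem exists_inverse {g : WW d →L[ℝ] WW d} (hg : |g.det| = 1) :
    ∃ g' : WW d →L[ℝ] WW d, (∀ v, g (g' v) = v) ∧ ∀ v, g' (g v) = v := by
  have : LinearMap.det (g : WW d →ₗ[ℝ] WW d) ≠ 0 := by
    intro h; rw [ContinuousLinearMap.det, h] at hg; simp at hg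
  set e := LinearMap.equivOfDetNeZero _ this with he
  exact ⟨LinearMap.toContinuousLinearMap (e.symm : WW d →ₗ[ℝ] WW d),
    fun v => e.apply_symm_apply v, fun v => e.symm_apply_apply v⟩

theorem unif_inj (C : ℝ) : ∃ c : ℝ, 0 < c ∧ ∀ g : WW d →L[ℝ] WW d, ‖g‖ ≤ C → |g.det| = 1 →
    ∀ v, c * ‖v‖ ≤ ‖g v‖ := by
  have hcont : Continuous fun f : WW d →L[ℝ] WW d => |f.det| :=
    ContinuousLinearMap.continuous_det.abs
  have hcomp : IsCompact ((closedBall (0 : WW d →L[ℝ] WW d) C ∩ {f | |f.det| = 1}) ×ˢ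
      (sphere (0 : WW d) 1)) :=
    ((isCompact_closedBall _ _).inter_right (isClosed_eq hcont continuous_const)).prod
      (isCompact_sphere _ _)
  have hf : Continuous fun p : (WW d →L[ℝ] WW d) × WW d => ‖p.1 p.2‖ :=
    (isBoundedBilinearMap_apply.continuous).norm
  obtain ⟨c, hc, h⟩ := hcomp.exists_forall_le' (f := fun p => ‖p.1 p.2‖) (a := 0)
    hf.continuousOn (by
      rintro ⟨g, v⟩ ⟨⟨-, hg⟩, hv⟩
      rw [norm_pos_iff]
      intro h0
      obtain ⟨g', -, h2⟩ := exists_inverse hg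
      have h3 := h2 v
      simp only at h0
      rw [h0, map_zero] at h3
      rw [← h3] at hv
      simp at hv)
  refine ⟨c, hc, fun g hg hdet v => ?_⟩
  rcases eq_or_ne v 0 with rfl | hv
  · simp
  have hv' : 0 < ‖v‖ := norm_pos_iff.2 hv
  have := h (g, ‖v‖⁻¹ • v) ⟨⟨by simpa using hg, hdet⟩, by
    simp [norm_smul, inv_mul_cancel₀ hv'.ne']⟩
  simp only [map_smul, norm_smul, norm_inv, norm_norm] at this
  rw [inv_mul_eq_div, le_div_iff₀ hv'] at this
  exact this

theorem isClosed_ZZ : IsClosed (ZZ d : Set (WW d)) := by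
  have : IsClosed ((Submodule.span ℤ (Set.range (bW d))).toAddSubgroup : Set (WW d)) :=
    AddSubgroup.isClosed_of_discrete
  exact this

theorem lat_limit {g g' : ℕ → (WW d →L[ℝ] WW d)} {h h' : WW d →L[ℝ] WW d}
    (hg : Tendsto g atTop (𝓝 h)) (hg' : Tendsto g' atTop (𝓝 h'))
    (hdet : ∀ k, |(g' k).det| = 1)
    (hsub : ∀ k, g k '' (ZZ d : Set (WW d)) ⊆ g' k '' (ZZ d : Set (WW d))) :
    h '' (ZZ d : Set (WW d)) ⊆ h' '' (ZZ d : Set (WW d)) := by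
  rintro _ ⟨m, hm, rfl⟩
  obtain ⟨C, hC⟩ := hg'.norm.bddAbove_range
  obtain ⟨c, hc, hinj⟩ := unif_inj (d := d) C
  have h1 : Tendsto (fun k => g k m) atTop (𝓝 (h m)) :=
    ((ContinuousLinearMap.apply ℝ (WW d) m).continuous.tendsto h).comp hg
  obtain ⟨B, hB⟩ := h1.norm.bddAbove_range
  choose m' hm' hgm using fun k => hsub k ⟨m, hm, rfl⟩
  have hbd : ∀ k, m' k ∈ closedBall (0 : WW d) (B / c) := by
    intro k
    have h2 := hinj (g' k) (hC ⟨k, rfl⟩) (hdet k) (m' k)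
    rw [hgm] at h2
    have h3 : ‖g k m‖ ≤ B := hB ⟨k, rfl⟩
    rw [mem_closedBall_zero_iff, le_div_iff₀ hc]
    linarith
  obtain ⟨m0, -, ψ, hψ, hlim⟩ := (isCompact_closedBall (0 : WW d) (B / c)).tendsto_subseq hbd
  have hm0 : m0 ∈ ZZ d := isClosed_ZZ.mem_of_tendsto hlim (Eventually.of_forall fun k => hm' _)
  refine ⟨m0, hm0, ?_⟩
  have h4 : Tendsto (fun k => g' (ψ k) (m' (ψ k))) atTop (𝓝 (h' m0)) :=
    (isBoundedBilinearMap_apply.continuous.tendsto (h', m0)).comp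
      ((hg'.comp hψ.tendsto_atTop).prodMk_nhds hlim)
  refine tendsto_nhds_unique h4 ((h1.comp hψ.tendsto_atTop).congr fun k => (hgm _).symm)

/-- block operator -/
def blk (x : EE d) (M : EE d →L[ℝ] EE d) (y : EE d →L[ℝ] ℝ) (c : ℝ) : WW d →L[ℝ] WW d :=
  (M.comp (ContinuousLinearMap.fst ℝ (EE d) ℝ) +
    (ContinuousLinearMap.snd ℝ (EE d) ℝ).smulRight x).prod
    (y.comp (ContinuousLinearMap.fst ℝ (EE d) ℝ) + c • ContinuousLinearMap.snd ℝ (EE d) ℝ)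

@[simp] theorem blk_apply (x : EE d) (M : EE d →L[ℝ] EE d) (y : EE d →L[ℝ] ℝ) (c : ℝ) (w : WW d) :
    blk x M y c w = (M w.1 + w.2 • x, y w.1 + c * w.2) := rfl

theorem blk_norm_le (x : EE d) (M : EE d →L[ℝ] EE d) (y : EE d →L[ℝ] ℝ) (c : ℝ) :
    ‖blk x M y c‖ ≤ ‖x‖ + ‖M‖ + ‖y‖ + |c| := by
  refine ContinuousLinearMap.opNorm_le_bound _ (by positivity) fun w => ?_
  have ha : ‖w.1‖ ≤ ‖w‖ := norm_fst_le w
  have hb : |w.2| ≤ ‖w‖ := norm_snd_le w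
  rw [blk_apply, Prod.norm_mk]
  have h1 : ‖M w.1 + w.2 • x‖ ≤ ‖M‖ * ‖w‖ + ‖w‖ * ‖x‖ := by
    refine (norm_add_le _ _).trans (add_le_add ((M.le_opNorm _).trans (by gcongr)) ?_)
    rw [norm_smul, Real.norm_eq_abs]; gcongr
  have h2 : ‖y w.1 + c * w.2‖ ≤ ‖y‖ * ‖w‖ + |c| * ‖w‖ := by
    refine (norm_add_le _ _).trans (add_le_add ((y.le_opNorm _).trans (by gcongr)) ?_)
    rw [Real.norm_eq_abs, abs_mul]; gcongr
  have := norm_nonneg w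
  have := norm_nonneg x
  have := norm_nonneg M
  have := norm_nonneg y
  have := abs_nonneg c
  apply max_le
  · nlinarith [mul_nonneg (norm_nonneg y) (norm_nonneg w), mul_nonneg (abs_nonneg c) (norm_nonneg w)]
  · nlinarith [mul_nonneg (norm_nonneg x) (norm_nonneg w), mul_nonneg (norm_nonneg M) (norm_nonneg w)]

theorem exists_blk (V : WW d →L[ℝ] WW d) : ∃ x M y c, V = blk x M y c ∧ ‖x‖ ≤ ‖V‖ ∧
    ‖M‖ ≤ ‖V‖ ∧ ‖y‖ ≤ ‖V‖ ∧ |c| ≤ ‖V‖ := by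
  have h01 : ‖((0 : EE d), (1 : ℝ))‖ = 1 := by simp [Prod.norm_mk]
  have ha0 : ∀ a : EE d, ‖(a, (0 : ℝ))‖ = ‖a‖ := by intro a; simp [Prod.norm_mk]
  refine ⟨(V (0, 1)).1,
    (ContinuousLinearMap.fst ℝ (EE d) ℝ).comp (V.comp (ContinuousLinearMap.inl ℝ (EE d) ℝ)),
    (ContinuousLinearMap.snd ℝ (EE d) ℝ).comp (V.comp (ContinuousLinearMap.inl ℝ (EE d) ℝ)),
    (V (0, 1)).2, ?_, ?_, ?_, ?_, ?_⟩
  · refine ContinuousLinearMap.ext fun w => ?_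
    have : w = (w.1, 0) + w.2 • ((0 : EE d), (1 : ℝ)) := by ext <;> simp
    conv_lhs => rw [this, map_add, map_smul]
    rw [blk_apply]
    ext <;> simp [mul_comm]
  · refine (norm_fst_le _).trans ((V.le_opNorm _).trans ?_); rw [h01, mul_one]
  · refine ContinuousLinearMap.opNorm_le_bound _ (norm_nonneg _) fun a => ?_
    refine (norm_fst_le _).trans ((V.le_opNorm _).trans ?_)
    simp [ha0]
  · refine ContinuousLinearMap.opNorm_le_bound _ (norm_nonneg _) fun a => ?_
    refine (norm_snd_le _).trans ((V.le_opNorm _).trans ?_)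
    simp [ha0]
  · refine (norm_snd_le (V (0,1))).trans ((V.le_opNorm _).trans ?_); rw [h01, mul_one]

theorem tendsto_sh {t : ℕ → EE d} {t' : EE d} (h : Tendsto t atTop (𝓝 t')) :
    Tendsto (fun k => sh (t k)) atTop (𝓝 (sh t')) := by
  rw [tendsto_iff_norm_sub_tendsto_zero] at h ⊢
  refine squeeze_zero (fun _ => norm_nonneg _) (fun k => ?_) h
  have : sh (t k) - sh t' = blk (t' - t k) 0 0 0 := by
    refine ContinuousLinearMap.ext fun w => ?_
    ext <;> simp [smul_sub]
  rw [this]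
  refine (blk_norm_le _ _ _ _).trans ?_
  simp [norm_sub_rev]

theorem kap_one : kap d 1 = 1 := by simp [kap]

theorem HH_sub (L L' : EE d →L[ℝ] EE d) : HH L 1 - HH L' 1 = blk 0 (L - L') 0 0 := by
  refine ContinuousLinearMap.ext fun w => ?_
  ext <;> simp [kap_one]

theorem HH_one : HH (idE d) 1 = idW d := by
  refine ContinuousLinearMap.ext fun w => ?_
  ext <;> simp [kap_one]

theorem tendsto_HH {L : ℕ → (EE d →L[ℝ] EE d)} {L' : EE d →L[ℝ] EE d}
    (h : Tendsto L atTop (𝓝 L')) : Tendsto (fun k => HH (L k) 1) atTop (𝓝 (HH L' 1)) := by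
  rw [tendsto_iff_norm_sub_tendsto_zero] at h ⊢
  refine squeeze_zero (fun _ => norm_nonneg _) (fun k => ?_) h
  rw [HH_sub]
  refine (blk_norm_le _ _ _ _).trans ?_
  simp

theorem tendsto_clm_comp {f g : ℕ → (WW d →L[ℝ] WW d)} {f' g' : WW d →L[ℝ] WW d}
    (hf : Tendsto f atTop (𝓝 f')) (hg : Tendsto g atTop (𝓝 g')) :
    Tendsto (fun k => (f k).comp (g k)) atTop (𝓝 (f'.comp g')) :=
  ((isBoundedBilinearMap_comp (𝕜 := ℝ) (E := WW d) (F := WW d)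
    (G := WW d)).continuous.tendsto (f', g')).comp (hf.prodMk_nhds hg)


theorem no_case2 {ε s0 s1 δ : ℝ} (hε : 0 < ε) (hs0 : 0 < s0) :
    ∃ r0 : ℝ, ∀ r : ℝ, r0 ≤ r → ∀ Λ : Set (WW d), IsLat Λ → Good ε Λ 0 →
      ∀ (x : EE d) (M : EE d →L[ℝ] EE d) (y : EE d →L[ℝ] ℝ) (c : ℝ),
      ∀ L : EE d →L[ℝ] EE d, ∀ s : EE d, |c| ≤ 1 / 2 →
      |(idW d + blk x M y c).det| = 1 → IsSim L 1 → s0 * r ≤ ‖s‖ → ‖s‖ ≤ s1 * r →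
      ⇑(idW d + blk x M y c) '' Λ = HH L 1 '' (sh s '' Λ) →
      δ ≤ ‖x‖ + r * ‖M - c • idE d‖ + r ^ 2 * ‖y‖ := by
  by_contra hcon
  push Not at hcon
  choose r hr Λ hΛ hgood x M y c L s hc hdet hL hs hs' heq hlt using fun k : ℕ => hcon (k + 1)
  have hrpos : ∀ k, 0 < r k := fun k => lt_of_lt_of_le (by positivity) (hr k)
  have hSim : ∀ k, IsSim ((r k)⁻¹ • idE d) (r k)⁻¹ := fun k => by
    have := (isSim_one (d := d)).smul (inv_pos.2 (hrpos k))
    rwa [mul_one] at this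
  set D : ℕ → (WW d →L[ℝ] WW d) := fun k => HH ((r k)⁻¹ • idE d) (r k)⁻¹ with hD
  set Ek : ℕ → (WW d →L[ℝ] WW d) := fun k => blk ((r k)⁻¹ • x k) (M k) (r k • y k) (c k) with hEk
  have hcomm1 : ∀ k, (D k).comp (idW d + blk (x k) (M k) (y k) (c k))
      = (idW d + Ek k).comp (D k) := by
    intro k
    have := (hrpos k).ne'
    refine ContinuousLinearMap.ext fun w => ?_
    refine Prod.ext ?_ ?_
    · simp [hD, hEk, smul_smul]
      module
    · simp [hD, hEk]
      field_simp
  have hcomm2 : ∀ k w, D k (HH (L k) 1 (sh (s k) w)) =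
      HH (L k) 1 (sh ((r k)⁻¹ • s k) (D k w)) := by
    intro k w
    refine Prod.ext ?_ ?_
    · simp [hD, kap_one, smul_smul, smul_sub]
      module
    · simp [hD, kap_one]
  have hdetE : ∀ k, |(idW d + Ek k).det| = 1 := by
    intro k
    have h1 := congrArg (fun f : WW d →L[ℝ] WW d => |f.det|) (hcomm1 k)
    simp only [det_comp, abs_mul] at h1
    rw [HH_det (hSim k), hdet k, one_mul, mul_one] at h1
    exact h1.symm
  set Θ : ℕ → Set (WW d) := fun k => D k '' Λ k with hΘ
  have hΘlat : ∀ k, IsLat (Θ k) := fun k => (hΛ k).image (HH_det (hSim k))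
  have hΘgood : ∀ k, Good ε (Θ k) 0 := fun k => by
    have := good_HH (hSim k) (hgood k)
    rwa [map_zero] at this
  have hΘeq : ∀ k, (idW d + Ek k) '' Θ k = HH (L k) 1 '' (sh ((r k)⁻¹ • s k) '' Θ k) := by
    intro k
    have h1 : (idW d + Ek k) '' Θ k = D k '' ((idW d + blk (x k) (M k) (y k) (c k)) '' Λ k) := by
      rw [hΘ, Set.image_image, Set.image_image]
      exact Set.image_congr fun w _ => (congrArg (fun f : WW d →L[ℝ] WW d => f w) (hcomm1 k)).symm
    rw [h1, heq k]
    simp only [hΘ, Set.image_image]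
    exact Set.image_congr fun w _ => hcomm2 k w
  -- first subsequence
  have hσ : ∀ k, s0 ≤ ‖(r k)⁻¹ • s k‖ ∧ ‖(r k)⁻¹ • s k‖ ≤ s1 := by
    intro k
    rw [norm_smul, norm_inv, Real.norm_of_nonneg (hrpos k).le, inv_mul_eq_div]
    exact ⟨(le_div_iff₀ (hrpos k)).2 (hs k), (div_le_iff₀ (hrpos k)).2 (hs' k)⟩
  obtain ⟨⟨L', c', σ'⟩, hmem, χ, hχ, hlim⟩ := ((isCompact_closedBall (0 : EE d →L[ℝ] EE d) 1).prod
    ((isCompact_Icc (a := -(1/2 : ℝ)) (b := 1/2)).prod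
      (isCompact_closedBall (0 : EE d) s1))).tendsto_subseq
    (x := fun k => (L k, c k, (r k)⁻¹ • s k))
    (fun k => ⟨by simpa using (hL k).norm_le, abs_le.1 (hc k), by
      simpa only [mem_closedBall_zero_iff] using (hσ k).2⟩)
  have hL' : Tendsto (fun k => L (χ k)) atTop (𝓝 L') := (continuous_fst.tendsto _).comp hlim
  have hlim2 := (continuous_snd.tendsto _).comp hlim
  have hc' : Tendsto (fun k => c (χ k)) atTop (𝓝 c') := (continuous_fst.tendsto _).comp hlim2
  have hσ' : Tendsto (fun k => (r (χ k))⁻¹ • s (χ k)) atTop (𝓝 σ') :=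
    (continuous_snd.tendsto _).comp hlim2
  have hcmem : c' ∈ Set.Icc (-(1/2 : ℝ)) (1/2) := hmem.2.1
  -- Ek converges
  have hE0 : Tendsto (fun k => Ek k - c k • idW d) atTop (𝓝 0) := by
    rw [tendsto_zero_iff_norm_tendsto_zero]
    refine squeeze_zero (g := fun k : ℕ => δ / ((k : ℝ) + 1)) (fun _ => norm_nonneg _)
      (fun k => ?_) ?_
    · have h1 : Ek k - c k • idW d
          = blk ((r k)⁻¹ • x k) (M k - c k • idE d) (r k • y k) 0 := by
        refine ContinuousLinearMap.ext fun w => ?_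
        refine Prod.ext ?_ ?_
        · simp [hEk]; abel
        · simp [hEk]
      rw [h1]
      refine (blk_norm_le _ _ _ _).trans ?_
      have hp := hrpos k
      have h2 : ‖(r k)⁻¹ • x k‖ + ‖M k - c k • idE d‖ + ‖r k • y k‖ + |(0 : ℝ)|
          = (‖x k‖ + r k * ‖M k - c k • idE d‖ + r k ^ 2 * ‖y k‖) / r k := by
        rw [norm_smul, norm_smul, norm_inv, Real.norm_of_nonneg hp.le, abs_zero]
        field_simp
        ring
      rw [h2]
      have h3 : 0 ≤ ‖x k‖ + r k * ‖M k - c k • idE d‖ + r k ^ 2 * ‖y k‖ := by positivity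
      have h4 := hlt k
      exact div_le_div₀ (h3.trans h4.le) h4.le (by positivity) (hr k)
    · have h5 := (tendsto_one_div_add_atTop_nhds_zero_nat (𝕜 := ℝ)).const_mul δ
      rw [mul_zero] at h5
      refine h5.congr fun k => ?_
      rw [mul_one_div]
  have hE' : Tendsto (fun k => idW d + Ek (χ k)) atTop (𝓝 (idW d + c' • idW d)) := by
    have h1 := (hE0.comp hχ.tendsto_atTop).add (hc'.smul_const (idW d))
    rw [zero_add] at h1
    refine (tendsto_const_nhds.add (h1.congr fun k => ?_))
    simp
  have hcontdet : Continuous fun f : WW d →L[ℝ] WW d => |f.det| :=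
    ContinuousLinearMap.continuous_det.abs
  have hc0 : c' = 0 := by
    have h1 := (hcontdet.tendsto _).comp hE'
    have h2 : ((fun f : WW d →L[ℝ] WW d => |f.det|) ∘ fun k => idW d + Ek (χ k))
        = fun _ => (1 : ℝ) := by
      ext k; simp [hdetE]
    rw [h2] at h1
    have h3 := tendsto_nhds_unique h1 tendsto_const_nhds
    have h4 : ((idW d + c' • idW d : WW d →L[ℝ] WW d) : WW d →ₗ[ℝ] WW d)
        = (1 + c') • LinearMap.id := by
      ext w <;> simp [add_mul]
    rw [ContinuousLinearMap.det, h4, LinearMap.det_smul, LinearMap.det_id, mul_one, abs_pow] at h3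
    have h5 : 0 < 1 + c' := by linarith [hcmem.1]
    rw [abs_of_pos h5] at h3
    have h6 := (pow_eq_one_iff_of_nonneg h5.le (by simp)).1 h3
    linarith
  have hz : idW d + c' • idW d = idW d := by
    rw [hc0]
    refine ContinuousLinearMap.ext fun w => ?_
    simp
  rw [hz] at hE'
  obtain ⟨ψ, g, g', hψ, hg1, hg'1, hgΘ, hglim⟩ := extract hε (Λ := fun k => Θ (χ k))
    (fun k => hΘlat _) (fun k => hΘgood _)
  set θ : WW d →L[ℝ] WW d := (HH L' 1).comp (sh σ') with hθ
  have hlimA : Tendsto (fun k => ((HH (L (χ (ψ k))) 1).comp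
      (sh ((r (χ (ψ k)))⁻¹ • s (χ (ψ k))))).comp (g k)) atTop (𝓝 (θ.comp g')) := by
    have h1 := (tendsto_HH hL').comp hψ.tendsto_atTop
    have h2 := (tendsto_sh hσ').comp hψ.tendsto_atTop
    exact tendsto_clm_comp (tendsto_clm_comp h1 h2) hglim
  have hlimB : Tendsto (fun k => (idW d + Ek (χ (ψ k))).comp (g k)) atTop (𝓝 g') := by
    have := tendsto_clm_comp (hE'.comp hψ.tendsto_atTop) hglim
    rwa [ContinuousLinearMap.id_comp] at this
  have hsub := lat_limit hlimA hlimB (fun k => by rw [det_comp, abs_mul, hdetE, hg1, one_mul])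
    (fun k => by
      have h1 := hΘeq (χ (ψ k))
      have h2 : Θ (χ (ψ k)) = _ := hgΘ k
      rw [h2] at h1
      simp only [Set.image_image] at h1
      exact h1.symm.subset)
  have hgoodg : Good ε (g' '' (ZZ d : Set (WW d))) 0 :=
    good_limit hglim tendsto_const_nhds (Eventually.of_forall fun k => by
      rw [← hgΘ]; exact hΘgood _)
  have hlat : IsLat (g' '' (ZZ d : Set (WW d))) := ⟨g', hg'1, rfl⟩
  have hfix : ∀ m ∈ ZZ d, θ (g' m) = g' m := by
    intro m hm
    have h1 : θ (g' m) ∈ g' '' (ZZ d : Set (WW d)) := hsub ⟨m, hm, rfl⟩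
    have h2 := hlat.sub_mem h1 ⟨m, hm, rfl⟩
    have h3 := hgoodg.snd_ne hε _ h2 (by simp [hθ, kap_one])
    exact sub_eq_zero.1 h3
  have hθg : θ.comp g' = g' := by
    have : ((θ.comp g' : WW d →L[ℝ] WW d) : WW d →ₗ[ℝ] WW d) = (g' : WW d →ₗ[ℝ] WW d) := by
      refine (bW d).ext fun i => ?_
      exact hfix _ (Submodule.subset_span ⟨i, rfl⟩)
    exact ContinuousLinearMap.coe_injective this
  obtain ⟨gi, hgi, -⟩ := exists_inverse hg'1
  have h1 : θ (0, 1) = (0, 1) := by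
    have := congrArg (fun f : WW d →L[ℝ] WW d => f (gi (0, 1))) hθg
    simpa only [ContinuousLinearMap.comp_apply, hgi] using this
  have h2 : L' σ' = 0 := by
    have := congrArg Prod.fst h1
    simpa [hθ, kap_one] using this
  have h3 : Tendsto (fun k => L (χ k) ((r (χ k))⁻¹ • s (χ k))) atTop (𝓝 (L' σ')) :=
    (isBoundedBilinearMap_apply.continuous.tendsto (L', σ')).comp (hL'.prodMk_nhds hσ')
  rw [h2] at h3
  have h4 := h3.norm
  rw [norm_zero] at h4
  have h5 : s0 ≤ 0 := ge_of_tendsto h4 (Eventually.of_forall fun k => by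
    rw [(hL _).2, one_mul]; exact (hσ _).1)
  linarith
end BAK

namespace BAK
variable {d : ℕ}

structure Dat (K : Set (EE d)) where
  T0 : EE d →L[ℝ] EE d
  ρ : ℝ
  hT : IsSim T0 ρ
  hρ1 : ρ < 1
  hTK : ∀ y ∈ K, T0 y ∈ K
  h0 : (0 : EE d) ∈ K
  B : ℝ
  hB0 : 0 ≤ B
  hB : ∀ y ∈ K, ‖y‖ ≤ B
  l1 : EE d →L[ℝ] EE d
  ρ1 : ℝ
  hl1 : IsSim l1 ρ1
  s1 : EE d
  hs1 : s1 ≠ 0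
  hσ1 : ∀ y ∈ K, l1 y + s1 ∈ K
  c0 : ℝ
  hc0 : 0 < c0
  ρm : ℝ
  hρm : 0 < ρm
  hQ : ∀ (S : EE d →L[ℝ] EE d) (q : ℝ), IsSim S q → ∀ (x : EE d) (M : EE d →L[ℝ] EE d)
    (y : EE d →L[ℝ] ℝ), ∃ (l : EE d →L[ℝ] EE d) (s : EE d) (ρσ : ℝ), IsSim l ρσ ∧ ρm ≤ ρσ ∧
      (∀ z ∈ K, l z + s ∈ K) ∧
      c0 * (‖x‖ + q * ‖M‖ + q ^ 2 * ‖y‖) ≤ ‖x + M (S s) - (y (S s)) • (S s)‖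

def PP (ε : ℝ) (K A : Set (EE d)) (Λ : Set (WW d)) (S : EE d →L[ℝ] EE d) : Prop :=
  ∀ y ∈ K, ∀ a ∈ A, Good ε Λ (S y + a)

def CC (ε : ℝ) (K A : Set (EE d)) : Prop :=
  ∀ R : ℝ, ∃ (Λ : Set (WW d)) (S : EE d →L[ℝ] EE d) (r : ℝ), IsLat Λ ∧ IsSim S r ∧ R ≤ r ∧
    PP ε K A Λ S

variable {K : Set (EE d)} {ε : ℝ}

theorem Dat.pow_mem (D : Dat K) (l : ℕ) : ∀ y ∈ K, (D.T0 ^ l) y ∈ K := by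
  induction l with
  | zero => intro y hy; simpa using hy
  | succ l ih =>
    intro y hy
    rw [pow_succ]
    exact ih _ (D.hTK y hy)

theorem Dat.shrink (D : Dat K) {R q : ℝ} (hR : 0 < R) (hq : R ≤ q) :
    ∃ l : ℕ, q * D.ρ ^ l ∈ Set.Icc R (R / D.ρ) := by
  have hρ := D.hT.1
  have hqpos := hR.trans_le hq
  obtain ⟨l, h1, h2⟩ := exists_nat_pow_near_of_lt_one (x := R / q) (div_pos hR hqpos)
    ((div_le_one hqpos).2 hq) hρ D.hρ1
  refine ⟨l, ?_, ?_⟩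
  · rw [div_le_iff₀ hqpos] at h2; linarith
  · rw [le_div_iff₀ hρ]
    rw [lt_div_iff₀ hqpos, pow_succ] at h1
    nlinarith

theorem PP.zero (D : Dat K) {A : Set (EE d)} (hA : (0 : EE d) ∈ A) {Λ : Set (WW d)}
    {S : EE d →L[ℝ] EE d} (h : PP ε K A Λ S) : Good ε Λ 0 := by
  have := h 0 D.h0 0 hA
  rwa [map_zero, add_zero] at this

theorem CC.icc (D : Dat K) {A : Set (EE d)} (h : CC ε K A) {R : ℝ} (hR : 0 < R) :
    ∃ (Λ : Set (WW d)) (S : EE d →L[ℝ] EE d) (r : ℝ), IsLat Λ ∧ IsSim S r ∧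
      r ∈ Set.Icc R (R / D.ρ) ∧ PP ε K A Λ S := by
  obtain ⟨Λ, S, r, h1, h2, h3, h4⟩ := h R
  obtain ⟨l, hl⟩ := D.shrink hR h3
  exact ⟨Λ, S.comp (D.T0 ^ l), r * D.ρ ^ l, h1, h2.comp (D.hT.pow l), hl,
    fun y hy a ha => h4 _ (D.pow_mem l y hy) a ha⟩

theorem CC.of_pos {A : Set (EE d)} (h : ∀ R : ℝ, 0 < R → ∃ (Λ : Set (WW d))
    (S : EE d →L[ℝ] EE d) (r : ℝ), IsLat Λ ∧ IsSim S r ∧ R ≤ r ∧ PP ε K A Λ S) : CC ε K A := by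
  intro R
  obtain ⟨Λ, S, r, h1, h2, h3, h4⟩ := h (max R 1) (by positivity)
  exact ⟨Λ, S, r, h1, h2, (le_max_left _ _).trans h3, h4⟩

theorem CC.lim (D : Dat K) (hε : 0 < ε) {A : ℕ → Set (EE d)} (hA : ∀ k, CC ε K (A k))
    (h0 : ∀ k, (0 : EE d) ∈ A k) {A' : Set (EE d)}
    (hlim : ∀ a ∈ A', ∃ a' : ℕ → EE d, (∀ᶠ k in atTop, a' k ∈ A k) ∧ Tendsto a' atTop (𝓝 a)) :
    CC ε K A' := by
  apply CC.of_pos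
  intro R hR
  choose Λ S r hΛ hS hr hP using fun k => CC.icc D (hA k) hR
  obtain ⟨χ, S', r', hχ, hr', hS', hlimS⟩ := extract_sim hR hS hr
  obtain ⟨ψ, g, g', hψ, hg1, hg'1, hgΛ, hlimg⟩ := extract hε (Λ := fun k => Λ (χ k))
    (fun k => hΛ _) (fun k => (hP _).zero D (h0 _))
  refine ⟨g' '' (ZZ d : Set (WW d)), S', r', ⟨g', hg'1, rfl⟩, hS', hr'.1, fun y hy a ha => ?_⟩
  obtain ⟨a', ha', hlima⟩ := hlim a ha
  have hmono : Tendsto (fun k => χ (ψ k)) atTop atTop :=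
    hχ.tendsto_atTop.comp hψ.tendsto_atTop
  have h1 : Tendsto (fun k => S (χ (ψ k)) y) atTop (𝓝 (S' y)) :=
    ((ContinuousLinearMap.apply ℝ (EE d) y).continuous.tendsto S').comp
      (hlimS.comp hψ.tendsto_atTop)
  refine good_limit hlimg (h1.add (hlima.comp hmono)) ?_
  filter_upwards [hmono.eventually ha'] with k hk
  rw [← hgΛ k]
  exact hP _ y hy _ hk

theorem CC.translate {A : Set (EE d)} (h : CC ε K A) (t : EE d) :
    CC ε K {a | a + t ∈ A} := by
  intro R
  obtain ⟨Λ, S, r, h1, h2, h3, h4⟩ := h R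
  refine ⟨sh t '' Λ, S, r, h1.sh t, h2, h3, fun y hy a ha => ?_⟩
  rw [good_sh, add_assoc]
  exact h4 y hy _ ha

theorem pigeon {X : Type*} [PseudoMetricSpace X] [ProperSpace X] (x : X) (C η : ℝ) (hη : 0 < η) :
    ∃ J : ℕ, ∀ f : Fin (J + 1) → X, (∀ i, f i ∈ closedBall x C) →
      ∃ i j, i < j ∧ dist (f i) (f j) < η := by
  obtain ⟨t, -, hfin, hcov⟩ := finite_cover_balls_of_compact (isCompact_closedBall x C) (half_pos hη)
  refine ⟨hfin.toFinset.card, fun f hf => ?_⟩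
  have h1 : ∀ i, ∃ c, c ∈ t ∧ f i ∈ ball c (η / 2) := fun i => by
    have := hcov (hf i)
    simpa using this
  choose c hc hfc using h1
  obtain ⟨i, -, j, -, hij, heq⟩ := Finset.exists_ne_map_eq_of_card_lt_of_maps_to
    (s := Finset.univ) (t := hfin.toFinset) (f := c) (by simp) (fun i _ => by simpa using hc i)
  have hd : dist (f i) (f j) < η := by
    have h2 := hfc i
    have h3 := hfc j
    rw [← heq] at h3
    rw [mem_ball] at h2 h3
    have := dist_triangle_right (f i) (f j) (c i)
    linarith
  rcases lt_or_gt_of_ne hij with h | h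
  · exact ⟨i, j, h, hd⟩
  · exact ⟨j, i, h, by rwa [dist_comm]⟩

theorem sh_sh (s t : EE d) (Λ : Set (WW d)) : sh s '' (sh t '' Λ) = sh (s + t) '' Λ := by
  rw [Set.image_image]
  refine Set.image_congr fun w _ => ?_
  simp only [sh_apply, smul_add, Prod.mk.injEq, and_true]; abel

theorem pair1 (D : Dat K) (hε : 0 < ε) {A : Set (EE d)} (hC : CC ε K A) (hA0 : (0 : EE d) ∈ A)
    (δ η : ℝ) (hη : 0 < η) (hη2 : η ≤ 1 / 2) :
    ∃ (Λ : Set (WW d)) (S : EE d →L[ℝ] EE d) (r : ℝ) (L : EE d →L[ℝ] EE d)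
      (x : EE d) (M : EE d →L[ℝ] EE d) (y : EE d →L[ℝ] ℝ) (c : ℝ),
      IsLat Λ ∧ IsSim S r ∧ IsSim L 1 ∧ ‖L - idE d‖ ≤ η ∧ ‖x‖ ≤ η ∧ ‖M‖ ≤ η ∧
      ‖y‖ ≤ η ∧ |c| ≤ η ∧ PP ε K A Λ S ∧
      (∀ z ∈ K, ∀ a ∈ A, Good ε (⇑(idW d + blk x M y c) '' Λ) (S z + L a)) ∧
      δ ≤ ‖x‖ + r * ‖M - c • idE d‖ + r ^ 2 * ‖y‖ := by
  obtain ⟨Cg, hCg, hmah⟩ := mahlerW (d := d) (min ε 1) (lt_min hε one_pos)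
  obtain ⟨κ, hκ, hinj⟩ := unif_inj (d := d) Cg
  set η' := min η (κ * η / (Cg + 1)) with hη'
  have hη'pos : 0 < η' := lt_min hη (by positivity)
  obtain ⟨J, hJ⟩ := pigeon (0 : (WW d →L[ℝ] WW d) × (EE d →L[ℝ] EE d)) (max Cg 1) η' hη'pos
  have hρ := D.hT.1
  have hρ1 := D.hl1.1
  have hs1 : 0 < ‖D.s1‖ := norm_pos_iff.2 D.hs1
  set w := D.ρ ^ J * D.ρ1 with hw
  have hwpos : 0 < w := by positivity
  obtain ⟨r0, hr0⟩ := no_case2 (d := d) (ε := ε) (s0 := (1 - D.ρ) * ‖D.s1‖ / D.ρ1)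
    (s1 := 2 * ‖D.s1‖ / w) (δ := δ) hε (by
      have := D.hρ1
      have : 0 < 1 - D.ρ := by linarith
      positivity)
  obtain ⟨Λ0, S0, R0, hΛ0, hS0, hR0, hP0⟩ := hC (max r0 1 / w)
  have hR0pos : 0 < R0 := hS0.1
  have hrge : max r0 1 ≤ R0 * w := (div_le_iff₀ hwpos).1 hR0
  set r := R0 * w with hr
  have hrpos : 0 < r := by positivity
  set T : Fin (J + 1) → EE d := fun i => S0 ((D.T0 ^ (i : ℕ)) D.s1) with hTdef
  set Si : Fin (J + 1) → (EE d →L[ℝ] EE d) := fun i =>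
    S0.comp ((D.T0 ^ (i : ℕ)).comp (D.l1.comp (D.T0 ^ (J - (i : ℕ))))) with hSi
  have hSim : ∀ i, IsSim (Si i) r := by
    intro i
    have h1 := hS0.comp ((D.hT.pow (i : ℕ)).comp (D.hl1.comp (D.hT.pow (J - (i : ℕ)))))
    have h2 : R0 * (D.ρ ^ (i : ℕ) * (D.ρ1 * D.ρ ^ (J - (i : ℕ)))) = r := by
      have : D.ρ ^ J = D.ρ ^ (i : ℕ) * D.ρ ^ (J - (i : ℕ)) := by
        rw [← pow_add]; congr 1; have := i.2; omega
      rw [hr, hw, this]; ring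
    rw [h2] at h1
    exact h1
  have hPi : ∀ i, PP ε K A (sh (T i) '' Λ0) (Si i) := by
    intro i z hz a ha
    rw [good_sh]
    have h1 := hP0 _ (D.pow_mem i _ (D.hσ1 _ (D.pow_mem (J - i) z hz))) a ha
    rw [map_add, map_add] at h1
    have h2 : Si i z + a + T i = S0 ((D.T0 ^ (i : ℕ)) (D.l1 ((D.T0 ^ (J - (i : ℕ))) z)))
        + S0 ((D.T0 ^ (i : ℕ)) D.s1) + a := by
      simp only [hSi, hTdef, ContinuousLinearMap.comp_apply]; abel
    rw [h2]; exact h1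
  have hΛi : ∀ i, IsLat (sh (T i) '' Λ0) := fun i => hΛ0.sh _
  choose g hg1 hg2 hg3 using fun i => hmah _ (hΛi i) (((hPi i).zero D hA0).norm_ge hε)
  set Q : Fin (J + 1) → (EE d →L[ℝ] EE d) := fun i => r⁻¹ • Si i with hQdef
  have hQ : ∀ i, IsSim (Q i) 1 := fun i => by
    have := (hSim i).smul (inv_pos.2 hrpos)
    rwa [inv_mul_cancel₀ hrpos.ne'] at this
  obtain ⟨i, j, hij, hdist⟩ := hJ (fun i => (g i, Q i)) (fun i => by
    rw [mem_closedBall_zero_iff, Prod.norm_mk]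
    exact max_le_max (hg2 i) (hQ i).norm_le)
  rw [Prod.dist_eq, max_lt_iff, dist_eq_norm, dist_eq_norm] at hdist
  obtain ⟨hdg, hdQ⟩ := hdist
  simp only at hdg hdQ
  obtain ⟨Q', hQ', hQQ', hQ'Q⟩ := (hQ j).exists_inv
  rw [inv_one] at hQ'
  set L := (Q i).comp Q' with hL
  have hLsim : IsSim L 1 := by
    have := (hQ i).comp hQ'
    rwa [one_mul] at this
  have hLnorm : ‖L - idE d‖ ≤ η' := by
    refine ContinuousLinearMap.opNorm_le_bound _ hη'pos.le fun v => ?_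
    have h1 : (L - idE d) v = (Q i - Q j) (Q' v) := by
      simp [hL, hQQ']
    rw [h1]
    refine ((Q i - Q j).le_opNorm _).trans ?_
    rw [hQ'.2, one_mul]
    gcongr
  have hLS : ∀ z, L (Si j z) = Si i z := by
    intro z
    have h1 : ∀ k, Si k z = r • Q k z := fun k => by
      simp [hQdef, smul_smul, mul_inv_cancel₀ hrpos.ne']
    rw [h1, h1, map_smul, hL, ContinuousLinearMap.comp_apply, hQ'Q]
  obtain ⟨gi, hgi1, hgi2⟩ := exists_inverse (hg1 i)
  set V : WW d →L[ℝ] WW d := ((HH L 1).comp (g j) - g i).comp gi with hV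
  have hVg : ∀ m, (idW d + V) (g i m) = HH L 1 (g j m) := by
    intro m
    simp [hV, hgi2]
  have hVnorm : ‖V‖ ≤ η := by
    refine ContinuousLinearMap.opNorm_le_bound _ hη.le fun v => ?_
    have h1 : V v = (HH L 1 - HH (idE d) 1) (g j (gi v)) + (g j - g i) (gi v) := by
      simp only [hV, HH_one, ContinuousLinearMap.comp_apply, sub_apply,
        ContinuousLinearMap.id_apply]
      abel
    have h2 : ‖HH L 1 - HH (idE d) 1‖ ≤ η' := by
      rw [HH_sub]
      refine (blk_norm_le _ _ _ _).trans ?_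
      simpa using hLnorm
    have h3 : κ * ‖gi v‖ ≤ ‖v‖ := by
      have := hinj (g i) (hg2 i) (hg1 i) (gi v)
      rwa [hgi1] at this
    have h4 : ‖(HH L 1 - HH (idE d) 1) (g j (gi v))‖ ≤ η' * (Cg * ‖gi v‖) := by
      refine (ContinuousLinearMap.le_opNorm _ _).trans ?_
      have h5 : ‖g j (gi v)‖ ≤ Cg * ‖gi v‖ :=
        ((g j).le_opNorm _).trans (by gcongr; exact hg2 j)
      exact mul_le_mul h2 h5 (norm_nonneg _) hη'pos.le
    have h5 : ‖(g j - g i) (gi v)‖ ≤ η' * ‖gi v‖ := by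
      refine (ContinuousLinearMap.le_opNorm _ _).trans ?_
      rw [norm_sub_rev] at hdg
      gcongr
    have h6 : η' * (Cg + 1) ≤ κ * η := by
      rw [← le_div_iff₀ (by positivity)]; exact min_le_right _ _
    rw [h1]
    calc _ ≤ η' * (Cg + 1) * ‖gi v‖ := by
          refine (norm_add_le _ _).trans ?_; linarith
      _ ≤ κ * η * ‖gi v‖ := by gcongr
      _ = η * (κ * ‖gi v‖) := by ring
      _ ≤ η * ‖v‖ := by gcongr
  obtain ⟨x, M, y, c, hVb, hx, hM, hy, hc⟩ := exists_blk V
  rw [hVb] at hVg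
  have himg : ⇑(idW d + blk x M y c) '' (sh (T i) '' Λ0) = HH L 1 '' (sh (T j) '' Λ0) := by
    rw [hg3 i, hg3 j, Set.image_image, Set.image_image]
    exact Set.image_congr fun m _ => hVg m
  refine ⟨sh (T i) '' Λ0, Si i, r, L, x, M, y, c, hΛi i, hSim i, hLsim,
    hLnorm.trans (min_le_left _ _), hx.trans hVnorm, hM.trans hVnorm, hy.trans hVnorm,
    hc.trans hVnorm, hPi i, ?_, ?_⟩
  · intro z hz a ha
    rw [himg]
    have h1 := good_HH hLsim (hPi j z hz a ha)
    rwa [map_add, hLS] at h1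
  · have hnorm : ∀ k : ℕ, ‖(D.T0 ^ k) D.s1‖ = D.ρ ^ k * ‖D.s1‖ := fun k => (D.hT.pow k).2 _
    refine hr0 r ((le_max_left _ _).trans hrge) _ (hΛi i) ((hPi i).zero D hA0) x M y c L (T j - T i)
      ((hc.trans hVnorm).trans hη2) ?_ hLsim ?_ ?_ ?_
    · have h1 : (idW d + blk x M y c).comp (g i) = (HH L 1).comp (g j) :=
        ContinuousLinearMap.ext fun m => hVg m
      have h2 := congrArg (fun f : WW d →L[ℝ] WW d => |f.det|) h1
      simp only [det_comp, abs_mul] at h2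
      rwa [hg1, hg1, HH_det hLsim, mul_one, mul_one] at h2
    · have h1 : T j - T i = - S0 ((D.T0 ^ (i : ℕ)) D.s1 - (D.T0 ^ (j : ℕ)) D.s1) := by
        simp only [hTdef, map_sub]; abel
      rw [h1, norm_neg, hS0.2]
      have h2 := norm_sub_norm_le ((D.T0 ^ (i : ℕ)) D.s1) ((D.T0 ^ (j : ℕ)) D.s1)
      rw [hnorm, hnorm] at h2
      have h3 : D.ρ ^ (j : ℕ) ≤ D.ρ ^ ((i : ℕ) + 1) :=
        pow_le_pow_of_le_one hρ.le D.hρ1.le hij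
      have h4 : D.ρ ^ J ≤ D.ρ ^ (i : ℕ) :=
        pow_le_pow_of_le_one hρ.le D.hρ1.le (by have := i.2; omega)
      have h5 : (1 - D.ρ) * ‖D.s1‖ / D.ρ1 * r = R0 * ((1 - D.ρ) * ‖D.s1‖ * D.ρ ^ J) := by
        rw [hr, hw]; field_simp
      rw [h5]
      refine mul_le_mul_of_nonneg_left (le_trans ?_ h2) hR0pos.le
      rw [pow_succ] at h3
      have h6 : 0 ≤ (1 - D.ρ) * ‖D.s1‖ := mul_nonneg (by linarith [D.hρ1]) hs1.le
      calc (1 - D.ρ) * ‖D.s1‖ * D.ρ ^ J ≤ (1 - D.ρ) * ‖D.s1‖ * D.ρ ^ (i : ℕ) := by gcongr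
        _ = D.ρ ^ (i : ℕ) * ‖D.s1‖ - D.ρ ^ (i : ℕ) * D.ρ * ‖D.s1‖ := by ring
        _ ≤ _ := by gcongr
    · have h1 : T j - T i = S0 ((D.T0 ^ (j : ℕ)) D.s1 - (D.T0 ^ (i : ℕ)) D.s1) := by
        simp only [hTdef, map_sub]
      rw [h1, hS0.2]
      have h5 : 2 * ‖D.s1‖ / w * r = R0 * (2 * ‖D.s1‖) := by
        rw [hr]; field_simp
      rw [h5]
      refine mul_le_mul_of_nonneg_left ((norm_sub_le _ _).trans ?_) hR0pos.le
      rw [hnorm, hnorm]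
      have h6 : ∀ k : ℕ, D.ρ ^ k ≤ 1 := fun k => pow_le_one₀ hρ.le D.hρ1.le
      nlinarith [h6 i, h6 j]
    · rw [himg, sh_sh, sub_add_cancel]
end BAK

namespace BAK
variable {d : ℕ}
variable {K : Set (EE d)} {ε : ℝ}

theorem pair2 (D : Dat K) (hε : 0 < ε) {A : Set (EE d)} (hC : CC ε K A) (hA0 : (0 : EE d) ∈ A)
    (δ : ℝ) (hδ : 0 < δ) (η q1 : ℝ) (hη : 0 < η) (hq1 : 1 ≤ q1) :
    ∃ (Λ : Set (WW d)) (S : EE d →L[ℝ] EE d) (q : ℝ) (L : EE d →L[ℝ] EE d)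
      (x : EE d) (M : EE d →L[ℝ] EE d) (y : EE d →L[ℝ] ℝ) (c : ℝ),
      IsLat Λ ∧ IsSim S q ∧ q1 ≤ q ∧ IsSim L 1 ∧ ‖L - idE d‖ ≤ η ∧ ‖x‖ ≤ η ∧ ‖M‖ ≤ η ∧
      ‖y‖ ≤ η ∧ |c| ≤ η ∧ PP ε K A Λ S ∧
      (∀ z ∈ K, ∀ a ∈ A, Good ε (⇑(idW d + blk x M y c) '' Λ) (S z + L a)) ∧
      δ ≤ ‖x‖ + q * ‖M - c • idE d‖ + q ^ 2 * ‖y‖ ∧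
      ‖x‖ + q * ‖M - c • idE d‖ + q ^ 2 * ‖y‖ ≤ δ / D.ρ ^ 2 := by
  have hq1pos : 0 < q1 := by linarith
  set η' := min (min η (1 / 2)) (δ / (8 * q1 ^ 2)) with hη'
  have hη'pos : 0 < η' := lt_min (lt_min hη (by norm_num)) (by positivity)
  have hη'1 : η' ≤ η := (min_le_left _ _).trans (min_le_left _ _)
  have hη'2 : η' ≤ 1 / 2 := (min_le_left _ _).trans (min_le_right _ _)
  have hη'3 : η' * (8 * q1 ^ 2) ≤ δ := by
    rw [← le_div_iff₀ (by positivity)]; exact min_le_right _ _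
  obtain ⟨Λ, S, r, L, x, M, y, c, h1, h2, h3, h4, h5, h6, h7, h8, h9, h10, h11⟩ :=
    pair1 D hε hC hA0 δ η' hη'pos hη'2
  have hρ := D.hT.1
  have hMc : ‖M - c • idE d‖ ≤ 2 * η' := by
    refine (norm_sub_le _ _).trans ?_
    have : ‖c • idE d‖ ≤ |c| := by
      rw [norm_smul, Real.norm_eq_abs]
      exact mul_le_of_le_one_right (abs_nonneg _) (isSim_one (d := d)).norm_le
    linarith
  set F : ℝ → ℝ := fun q => ‖x‖ + q * ‖M - c • idE d‖ + q ^ 2 * ‖y‖ with hF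
  have hq1sq : q1 ≤ q1 ^ 2 := by nlinarith
  have hsmall : ∀ q, 0 ≤ q → q ≤ q1 → F q < δ := by
    intro q hq0 hq
    have e1 : q * ‖M - c • idE d‖ ≤ q1 ^ 2 * (2 * η') :=
      mul_le_mul (hq.trans hq1sq) hMc (norm_nonneg _) (by positivity)
    have e2 : q ^ 2 * ‖y‖ ≤ q1 ^ 2 * η' :=
      mul_le_mul (by gcongr) h7 (norm_nonneg _) (by positivity)
    have e3 : η' ≤ η' * q1 ^ 2 := le_mul_of_one_le_right hη'pos.le (by nlinarith)
    have e4 : 0 < η' * q1 ^ 2 := by positivity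
    simp only [hF]
    nlinarith
  have hex : ∃ l : ℕ, F (r * D.ρ ^ l) < δ := by
    have hlim : Tendsto (fun l : ℕ => r * D.ρ ^ l) atTop (𝓝 (r * 0)) :=
      (tendsto_pow_atTop_nhds_zero_of_lt_one hρ.le D.hρ1).const_mul r
    rw [mul_zero] at hlim
    obtain ⟨l, hl⟩ := (hlim.eventually (gt_mem_nhds hq1pos)).exists
    exact ⟨l, hsmall _ (mul_nonneg h2.1.le (by positivity)) hl.le⟩
  classical
  have hl0 : Nat.find hex ≠ 0 := by
    intro h0
    have := Nat.find_spec hex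
    rw [h0, pow_zero, mul_one] at this
    exact absurd h11 (not_le.2 this)
  obtain ⟨l, hl⟩ := Nat.exists_eq_succ_of_ne_zero hl0
  have hlt : F (r * D.ρ ^ (l + 1)) < δ := by
    have := Nat.find_spec hex
    rwa [hl] at this
  have hge : δ ≤ F (r * D.ρ ^ l) := by
    have := Nat.find_min hex (m := l) (by omega)
    exact not_lt.1 this
  have hqpos : 0 < r * D.ρ ^ l := mul_pos h2.1 (by positivity)
  refine ⟨Λ, S.comp (D.T0 ^ l), r * D.ρ ^ l, L, x, M, y, c, h1, h2.comp (D.hT.pow l), ?_, h3,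
    h4.trans hη'1, h5.trans hη'1, h6.trans hη'1, h7.trans hη'1, h8.trans hη'1,
    fun z hz a ha => h9 _ (D.pow_mem l z hz) a ha,
    fun z hz a ha => h10 _ (D.pow_mem l z hz) a ha, hge, ?_⟩
  · by_contra hcon
    push Not at hcon
    exact absurd hge (not_le.2 (hsmall _ hqpos.le hcon.le))
  · rw [le_div_iff₀ (by positivity)]
    refine le_trans ?_ hlt.le
    simp only [hF, pow_succ, pow_zero, one_mul]
    set q := r * D.ρ ^ l
    have e0 : r * (D.ρ ^ l * D.ρ) = q * D.ρ := by simp only [q]; ring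
    rw [e0]
    have hρ1 := D.hρ1
    have e1 : D.ρ * D.ρ ≤ D.ρ := by nlinarith
    have e2 : ‖x‖ * (D.ρ * D.ρ) ≤ ‖x‖ := mul_le_of_le_one_right (norm_nonneg _) (by nlinarith)
    have e3 : q * ‖M - c • idE d‖ * (D.ρ * D.ρ) ≤ q * ‖M - c • idE d‖ * D.ρ :=
      mul_le_mul_of_nonneg_left e1 (by positivity)
    nlinarith

theorem sh_blk (t x : EE d) (M : EE d →L[ℝ] EE d) (y : EE d →L[ℝ] ℝ) (c : ℝ) (w : WW d) :
    sh t ((idW d + blk x M y c) w) = (idW d + blk (x + (M - c • idE d) t - (y t) • t)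
      (M - y.smulRight t) y (c + y t)) (sh t w) := by
  refine Prod.ext ?_ ?_
  · simp
    module
  · simp
    ring

theorem pair3 (D : Dat K) (hε : 0 < ε) {A : Set (EE d)} (hC : CC ε K A) (hA0 : (0 : EE d) ∈ A)
    (δ : ℝ) (hδ : 0 < δ) (η q1 : ℝ) (hη : 0 < η) :
    ∃ (Λ : Set (WW d)) (S : EE d →L[ℝ] EE d) (q : ℝ) (L : EE d →L[ℝ] EE d)
      (V : WW d →L[ℝ] WW d) (x : EE d),
      IsLat Λ ∧ IsSim S q ∧ q1 ≤ q ∧ IsSim L 1 ∧ ‖L - idE d‖ ≤ η ∧ PP ε K A Λ S ∧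
      (∀ z ∈ K, ∀ a ∈ A, Good ε (⇑(idW d + V) '' Λ) (S z + L a)) ∧
      ‖V - blk x 0 0 0‖ ≤ η ∧
      D.c0 * δ ≤ ‖x‖ ∧ ‖x‖ ≤ (1 + D.B) ^ 2 * (δ / D.ρ ^ 2) := by
  have hρ := D.hT.1
  have hB0 := D.hB0
  have hρm := D.hρm
  set δ' := δ / D.ρ ^ 2 with hδ'
  have hδ'pos : 0 < δ' := by positivity
  set q2 := max (max (4 * δ' * D.B / η) (q1 / D.ρm)) 1 with hq2
  obtain ⟨Λ, S, q, L, x, M, y, c, h1, h2, h3, h4, h5, h6, h7, h8, h9, h10, h11, h12, h13⟩ :=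
    pair2 D hε hC hA0 δ hδ (η / 6) q2 (by positivity) (le_max_right _ _)
  have hqa : 4 * δ' * D.B / η ≤ q := ((le_max_left _ _).trans (le_max_left _ _)).trans h3
  have hqb : q1 / D.ρm ≤ q := ((le_max_right _ _).trans (le_max_left _ _)).trans h3
  have hq := h2.1
  obtain ⟨l, s, ρσ, hl, hρσ, hσ, hnv⟩ := D.hQ S q h2 x (M - c • idE d) y
  have hs : ‖s‖ ≤ D.B := by
    have := D.hB _ (hσ 0 D.h0)
    rwa [map_zero, zero_add] at this
  set t := S s with ht
  have htn : ‖t‖ ≤ q * D.B := by rw [ht, h2.2]; gcongr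
  set V := blk (x + (M - c • idE d) t - (y t) • t) (M - y.smulRight t) y (c + y t) with hV
  have hyt : ‖y‖ * ‖t‖ ≤ η / 4 := by
    have e1 : q ^ 2 * ‖y‖ ≤ δ' := by
      have : 0 ≤ ‖x‖ + q * ‖M - c • idE d‖ := by positivity
      linarith
    rw [div_le_iff₀ hη] at hqa
    have e2 : q * (‖y‖ * ‖t‖) ≤ q * (η / 4) := by
      calc q * (‖y‖ * ‖t‖) ≤ q * (‖y‖ * (q * D.B)) := by gcongr
        _ = (q ^ 2 * ‖y‖) * D.B := by ring
        _ ≤ δ' * D.B := by gcongr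
        _ ≤ q * (η / 4) := by linarith
    exact le_of_mul_le_mul_left e2 hq
  refine ⟨sh t '' Λ, S.comp l, q * ρσ, L, V, x + (M - c • idE d) t - (y t) • t, h1.sh t,
    h2.comp hl, ?_, h4, by linarith, ?_, ?_, ?_, ?_, ?_⟩
  · rw [div_le_iff₀ hρm] at hqb
    exact hqb.trans (by gcongr)
  · intro z hz a ha
    rw [good_sh]
    have := h10 _ (hσ z hz) a ha
    rw [map_add] at this
    have e : S.comp l z + a + t = S (l z) + S s + a := by
      rw [ContinuousLinearMap.comp_apply, ht]; abel
    rwa [e]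
  · intro z hz a ha
    have := h11 _ (hσ z hz) a ha
    rw [map_add] at this
    have e : S (l z) + S s + L a = (S.comp l z + L a) + t := by
      rw [ContinuousLinearMap.comp_apply, ht]; abel
    rw [e, ← good_sh, Set.image_image] at this
    rw [Set.image_image]
    convert this using 1
    exact Set.image_congr fun w _ => (sh_blk t x M y c w).symm
  · have e1 : V - blk (x + (M - c • idE d) t - (y t) • t) 0 0 0
        = blk 0 (M - y.smulRight t) y (c + y t) := by
      refine ContinuousLinearMap.ext fun w => ?_
      refine Prod.ext ?_ ?_
      · simp [hV]
      · simp [hV]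
    rw [e1]
    refine (blk_norm_le _ _ _ _).trans ?_
    have e2 : ‖M - y.smulRight t‖ ≤ η / 6 + η / 4 := by
      refine (norm_sub_le _ _).trans ?_
      rw [ContinuousLinearMap.norm_smulRight_apply]
      linarith
    have e3 : |c + y t| ≤ η / 6 + η / 4 := by
      refine (abs_add_le _ _).trans ?_
      have : |y t| ≤ ‖y‖ * ‖t‖ := y.le_opNorm t
      linarith
    rw [norm_zero]
    linarith
  · refine le_trans ?_ hnv
    exact mul_le_mul_of_nonneg_left h12 D.hc0.le
  · have e1 : ‖(M - c • idE d) t‖ ≤ ‖M - c • idE d‖ * (q * D.B) :=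
      ((M - c • idE d).le_opNorm t).trans (by gcongr)
    have e2 : ‖(y t) • t‖ ≤ ‖y‖ * (q * D.B) * (q * D.B) := by
      rw [norm_smul]
      have : ‖y t‖ ≤ ‖y‖ * (q * D.B) := (y.le_opNorm t).trans (by gcongr)
      exact mul_le_mul this htn (norm_nonneg _) (by positivity)
    have e3 : ‖x + (M - c • idE d) t - (y t) • t‖ ≤ (1 + D.B) ^ 2 *
        (‖x‖ + q * ‖M - c • idE d‖ + q ^ 2 * ‖y‖) := by
      refine (norm_sub_le _ _).trans ?_
      have := norm_add_le x ((M - c • idE d) t)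
      have n1 : 0 ≤ ‖x‖ := norm_nonneg _
      have n2 : 0 ≤ q * ‖M - c • idE d‖ := by positivity
      have n3 : 0 ≤ q ^ 2 * ‖y‖ := by positivity
      have k1 : (1 + D.B) ^ 2 * ‖x‖ = ‖x‖ + (2 * D.B + D.B ^ 2) * ‖x‖ := by ring
      have k2 : 0 ≤ (2 * D.B + D.B ^ 2) * ‖x‖ := by positivity
      have k3 : 0 ≤ (1 + D.B + D.B ^ 2) * (q * ‖M - c • idE d‖) := by positivity
      have k4 : 0 ≤ (1 + 2 * D.B) * (q ^ 2 * ‖y‖) := by positivity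
      nlinarith
    exact e3.trans (by gcongr)

theorem step (D : Dat K) (hε : 0 < ε) {A : Set (EE d)} (hC : CC ε K A) (hA0 : (0 : EE d) ∈ A)
    (δ : ℝ) (hδ : 0 < δ) :
    ∃ p : EE d, D.c0 * δ ≤ ‖p‖ ∧ ‖p‖ ≤ (1 + D.B) ^ 2 * (δ / D.ρ ^ 2) ∧
      CC ε K (A ∪ {a | a + p ∈ A}) := by
  choose Λ S q L V x h1 h2 h3 h4 h5 h6 h7 h8 h9 h10 using fun k : ℕ =>
    pair3 D hε hC hA0 δ hδ (1 / ((k : ℝ) + 1)) k (by positivity)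
  obtain ⟨p, hp, χ, hχ, hlim⟩ := (isCompact_closedBall (0 : EE d)
    ((1 + D.B) ^ 2 * (δ / D.ρ ^ 2))).tendsto_subseq (x := x) (fun k => by simpa using h10 k)
  refine ⟨p, ge_of_tendsto' hlim.norm fun k => h9 _, by simpa using hp, CC.of_pos ?_⟩
  intro R hR
  obtain ⟨N, hN⟩ := exists_nat_ge R
  -- shift so that q ≥ R
  set θ : ℕ → ℕ := fun k => χ (k + N) with hθ
  have hθm : StrictMono θ := fun a b hab => hχ (by omega)
  have hθN : ∀ k, R ≤ q (θ k) := fun k => by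
    refine hN.trans (le_trans ?_ (h3 (θ k)))
    have : N ≤ θ k := (Nat.le_add_left N k).trans hχ.le_apply
    exact_mod_cast this
  choose l hl using fun k => D.shrink hR (hθN k)
  obtain ⟨ψ1, S', r', hψ1, hr', hS', hlimS⟩ := extract_sim hR
    (fun k => (h2 (θ k)).comp (D.hT.pow (l k))) hl
  obtain ⟨ψ, g, g', hψ, hg1, hg'1, hgΛ, hlimg⟩ := extract hε (Λ := fun k => Λ (θ (ψ1 k)))
    (fun k => h1 _) (fun k => (h6 _).zero D hA0)
  have hm : Tendsto (fun k => θ (ψ1 (ψ k))) atTop atTop :=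
    hθm.tendsto_atTop.comp (hψ1.tendsto_atTop.comp hψ.tendsto_atTop)
  have hSy : ∀ y, Tendsto (fun k => (S (θ (ψ1 (ψ k)))) ((D.T0 ^ l (ψ1 (ψ k))) y)) atTop (𝓝 (S' y)) :=
    fun y => ((ContinuousLinearMap.apply ℝ (EE d) y).continuous.tendsto S').comp
      (hlimS.comp hψ.tendsto_atTop)
  have hsm : Tendsto (fun k => 1 / (((θ (ψ1 (ψ k)) : ℕ) : ℝ) + 1)) atTop (𝓝 0) :=
    (tendsto_one_div_add_atTop_nhds_zero_nat (𝕜 := ℝ)).comp hm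
  have hx : Tendsto (fun k => x (θ (ψ1 (ψ k)))) atTop (𝓝 p) := by
    have e1 : Tendsto (fun k => ψ1 (ψ k) + N) atTop atTop :=
      (tendsto_add_atTop_nat N).comp (hψ1.tendsto_atTop.comp hψ.tendsto_atTop)
    exact hlim.comp e1
  have hL : Tendsto (fun k => L (θ (ψ1 (ψ k)))) atTop (𝓝 (idE d)) := by
    rw [tendsto_iff_norm_sub_tendsto_zero]
    exact squeeze_zero (fun _ => norm_nonneg _) (fun k => h5 _) hsm
  have hVlim : Tendsto (fun k => idW d + V (θ (ψ1 (ψ k)))) atTop (𝓝 (sh (-p))) := by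
    have e1 : Tendsto (fun k => sh (-x (θ (ψ1 (ψ k))))) atTop (𝓝 (sh (-p))) := tendsto_sh hx.neg
    have e2 : Tendsto (fun k => V (θ (ψ1 (ψ k))) - blk (x (θ (ψ1 (ψ k)))) 0 0 0) atTop (𝓝 0) := by
      rw [tendsto_zero_iff_norm_tendsto_zero]
      exact squeeze_zero (fun _ => norm_nonneg _) (fun k => h8 _) hsm
    have e3 := e1.add e2
    rw [add_zero] at e3
    refine e3.congr fun k => ?_
    refine ContinuousLinearMap.ext fun w => ?_
    refine Prod.ext ?_ ?_
    · simp
    · simp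
  refine ⟨g' '' (ZZ d : Set (WW d)), S', r', ⟨g', hg'1, rfl⟩, hS', hr'.1, fun y hy a ha => ?_⟩
  rcases ha with ha | ha
  · refine good_limit hlimg ((hSy y).add tendsto_const_nhds) (Eventually.of_forall fun k => ?_)
    rw [← hgΛ k]
    exact h6 _ _ (D.pow_mem _ y hy) _ ha
  · have e0 : ∀ k, Good ε (⇑((idW d + V (θ (ψ1 (ψ k)))).comp (g k)) '' (ZZ d : Set (WW d)))
        ((S (θ (ψ1 (ψ k)))) ((D.T0 ^ l (ψ1 (ψ k))) y) + L (θ (ψ1 (ψ k))) (a + p)) := by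
      intro k
      have e2 := h7 (θ (ψ1 (ψ k))) _ (D.pow_mem (l (ψ1 (ψ k))) y hy) (a + p) ha
      rw [hgΛ k, Set.image_image] at e2
      exact e2
    have e1 := good_limit (tendsto_clm_comp hVlim hlimg) ((hSy y).add
      (((ContinuousLinearMap.apply ℝ (EE d) (a + p)).continuous.tendsto _).comp hL))
      (ε := ε) (Eventually.of_forall e0)
    have e3 : ⇑((sh (-p)).comp g') '' (ZZ d : Set (WW d)) = sh (-p) '' (g' '' (ZZ d : Set (WW d))) := by
      rw [Set.image_image]; rfl
    rw [e3, good_sh] at e1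
    simpa [add_assoc] using e1
end BAK

namespace BAK
variable {d : ℕ}
variable {K : Set (EE d)} {ε : ℝ}

theorem CC.mono {A A' : Set (EE d)} (h : CC ε K A) (hA : A' ⊆ A) : CC ε K A' := by
  intro R
  obtain ⟨Λ, S, r, h1, h2, h3, h4⟩ := h R
  exact ⟨Λ, S, r, h1, h2, h3, fun y hy a ha => h4 y hy a (hA ha)⟩

theorem chain (D : Dat K) (hε : 0 < ε) (hC : CC ε K {0}) (δ : ℝ) (hδ : 0 < δ) :
    ∃ p : ℕ → EE d, (∀ n, D.c0 * δ ≤ ‖p n‖ ∧ ‖p n‖ ≤ (1 + D.B) ^ 2 * (δ / D.ρ ^ 2)) ∧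
      CC ε K {a | ∃ F : Finset ℕ, a = - ∑ i ∈ F, p i} := by
  classical
  let St := {A : Set (EE d) // CC ε K A ∧ (0 : EE d) ∈ A}
  choose P hP1 hP2 hP3 using fun A : St => step D hε A.2.1 A.2.2 δ hδ
  let nx : St → St := fun A => ⟨A.1 ∪ {a | a + P A ∈ A.1}, hP3 A, Or.inl A.2.2⟩
  let seq : ℕ → St := fun n => Nat.rec ⟨{0}, hC, rfl⟩ (fun _ A => nx A) n
  have hseq : ∀ n, (seq (n + 1)).1 = (seq n).1 ∪ {a | a + P (seq n) ∈ (seq n).1} := fun n => rfl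
  have hmem : ∀ n, ∀ F : Finset ℕ, F ⊆ Finset.range n → - ∑ i ∈ F, P (seq i) ∈ (seq n).1 := by
    intro n
    induction n with
    | zero =>
      intro F hF
      have : F = ∅ := by simpa using hF
      subst this
      simpa using (seq 0).2.2
    | succ n ih =>
      intro F hF
      rw [hseq]
      by_cases hn : n ∈ F
      · right
        have h1 : F.erase n ⊆ Finset.range n := by
          intro i hi
          rw [Finset.mem_erase] at hi
          have := hF hi.2
          rw [Finset.mem_range] at this ⊢
          omega
        have h2 := ih _ h1
        have h3 := Finset.sum_erase_add F (fun i => P (seq i)) hn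
        have h4 : - ∑ i ∈ F, P (seq i) + P (seq n) = - ∑ i ∈ F.erase n, P (seq i) := by
          rw [← h3]; abel
        change _ ∈ (seq n).1
        rw [h4]; exact h2
      · left
        apply ih
        intro i hi
        have := hF hi
        rw [Finset.mem_range] at this ⊢
        have : i ≠ n := fun h => hn (h ▸ hi)
        omega
  refine ⟨fun n => P (seq n), fun n => ⟨hP1 _, hP2 _⟩, ?_⟩
  refine CC.lim D hε (A := fun n => (seq n).1) (fun n => (seq n).2.1) (fun n => (seq n).2.2) ?_
  rintro a ⟨F, rfl⟩
  refine ⟨fun _ => - ∑ i ∈ F, P (seq i), ?_, tendsto_const_nhds⟩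
  filter_upwards [eventually_ge_atTop (F.sup id + 1)] with n hn
  apply hmem
  intro i hi
  have := Finset.le_sup (f := id) hi
  simp only [id] at this
  rw [Finset.mem_range]; omega

theorem multiples (D : Dat K) (hε : 0 < ε) (hC : CC ε K {0}) (δ : ℝ) (hδ : 0 < δ) :
    ∃ p : EE d, D.c0 * δ ≤ ‖p‖ ∧ ‖p‖ ≤ (1 + D.B) ^ 2 * (δ / D.ρ ^ 2) ∧
      CC ε K (Set.range fun j : ℤ => j • p) := by
  classical
  obtain ⟨p, hp, hCp⟩ := chain D hε hC δ hδ
  obtain ⟨p', hp', i, hi, hlim⟩ := (isCompact_closedBall (0 : EE d)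
    ((1 + D.B) ^ 2 * (δ / D.ρ ^ 2))).tendsto_subseq (x := p) (fun k => by simpa using (hp k).2)
  refine ⟨p', ge_of_tendsto' hlim.norm fun k => (hp _).1, by simpa using hp', ?_⟩
  set b : ℕ → EE d := fun k => p (i k) with hb
  have hbl : Tendsto b atTop (𝓝 p') := hlim
  have hB : ∀ m n, - ∑ k ∈ Finset.Ico m n, b k ∈ {a | ∃ F : Finset ℕ, a = - ∑ i ∈ F, p i} := by
    intro m n
    refine ⟨(Finset.Ico m n).image i, ?_⟩
    rw [Finset.sum_image (fun x _ y _ h => hi.injective h)]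
  generalize {a | ∃ F : Finset ℕ, a = - ∑ i ∈ F, p i} = Bs at hB hCp
  refine CC.lim D hε (A := fun k => {a | a + (- ∑ m ∈ Finset.Ico k (2 * k), b m) ∈ Bs}) (fun k => hCp.translate _) (fun k => ?_) ?_
  · simp only [Set.mem_ofPred_eq, zero_add]
    exact hB _ _
  have hshift : ∀ (n : ℕ) (f : ℕ → ℕ), Tendsto f atTop atTop →
      Tendsto (fun k => ∑ l ∈ Finset.range n, b (f k + l)) atTop (𝓝 (n • p')) := by
    intro n f hf
    have h1 : Tendsto (fun k => ∑ l ∈ Finset.range n, b (f k + l)) atTop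
        (𝓝 (∑ l ∈ Finset.range n, p')) :=
      tendsto_finsetSum _ fun l _ => hbl.comp ((tendsto_add_atTop_nat l).comp hf)
    simpa using h1
  rintro a ⟨j, rfl⟩
  obtain ⟨n, rfl | rfl⟩ := j.eq_nat_or_neg
  · refine ⟨fun k => ∑ l ∈ Finset.range n, b (2 * k - n + l), ?_, ?_⟩
    · filter_upwards [eventually_ge_atTop n] with k hk
      have h1 : ∑ m ∈ Finset.Ico k (2 * k), b m
          = ∑ m ∈ Finset.Ico k (2 * k - n), b m + ∑ l ∈ Finset.range n, b (2 * k - n + l) := by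
        rw [← Finset.sum_Ico_consecutive b (show k ≤ 2 * k - n by omega)
          (show 2 * k - n ≤ 2 * k by omega), Finset.sum_Ico_eq_sum_range b (2 * k - n)]
        congr 3; omega
      have h2 := hB k (2 * k - n)
      rw [h1]
      convert h2 using 1
      abel
    · simpa using hshift n (fun k => 2 * k - n)
        (tendsto_atTop_atTop.2 fun c => ⟨c + n, fun k hk => by omega⟩)
  · refine ⟨fun k => - ∑ l ∈ Finset.range n, b (2 * k + l), ?_, ?_⟩
    · refine Eventually.of_forall fun k => ?_
      have h1 : ∑ m ∈ Finset.Ico k (2 * k + n), b m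
          = ∑ m ∈ Finset.Ico k (2 * k), b m + ∑ l ∈ Finset.range n, b (2 * k + l) := by
        rw [← Finset.sum_Ico_consecutive b (show k ≤ 2 * k by omega)
          (show 2 * k ≤ 2 * k + n by omega), Finset.sum_Ico_eq_sum_range b (2 * k)]
        congr 3; omega
      have h2 := hB k (2 * k + n)
      rw [Set.mem_ofPred_eq]
      rw [h1] at h2
      convert h2 using 1
      abel
    · simpa using (hshift n (fun k => 2 * k)
        (tendsto_atTop_atTop.2 fun c => ⟨c, fun k hk => by omega⟩)).neg

theorem line (D : Dat K) (hε : 0 < ε) (hC : CC ε K {0}) :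
    ∃ v : EE d, ‖v‖ = 1 ∧ CC ε K (Set.range fun τ : ℝ => τ • v) := by
  choose p h1 h2 h3 using fun k : ℕ => multiples D hε hC (1 / ((k : ℝ) + 1)) (by positivity)
  have hpos : ∀ k, 0 < ‖p k‖ := fun k => lt_of_lt_of_le (mul_pos D.hc0 (by positivity)) (h1 k)
  obtain ⟨v, hv, i, hi, hlim⟩ := (isCompact_sphere (0 : EE d) 1).tendsto_subseq
    (x := fun k => ‖p k‖⁻¹ • p k) (fun k => by
      rw [mem_sphere_zero_iff_norm, norm_smul, norm_inv, norm_norm,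
        inv_mul_cancel₀ (hpos k).ne'])
  have hp0 : Tendsto (fun k => ‖p k‖) atTop (𝓝 0) := by
    have e1 : Tendsto (fun k : ℕ => (1 + D.B) ^ 2 * ((1 / ((k : ℝ) + 1)) / D.ρ ^ 2)) atTop (𝓝 0) := by
      have := ((tendsto_one_div_add_atTop_nhds_zero_nat (𝕜 := ℝ)).div_const (D.ρ ^ 2)).const_mul
        ((1 + D.B) ^ 2)
      simpa using this
    exact squeeze_zero (fun _ => norm_nonneg _) h2 e1
  refine ⟨v, by simpa using hv, ?_⟩
  refine CC.lim D hε (fun k => h3 (i k)) (fun k => ⟨0, by simp⟩) ?_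
  rintro _ ⟨τ, rfl⟩
  refine ⟨fun k => ⌊τ / ‖p (i k)‖⌋ • p (i k), Eventually.of_forall fun k => ⟨_, rfl⟩, ?_⟩
  have e1 : Tendsto (fun k => (⌊τ / ‖p (i k)‖⌋ : ℝ) * ‖p (i k)‖) atTop (𝓝 τ) := by
    rw [tendsto_iff_norm_sub_tendsto_zero]
    refine squeeze_zero (fun _ => norm_nonneg _) (fun k => ?_) (hp0.comp hi.tendsto_atTop)
    have hk := hpos (i k)
    have a1 := Int.floor_le (τ / ‖p (i k)‖)
    have a2 := Int.lt_floor_add_one (τ / ‖p (i k)‖)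
    rw [le_div_iff₀ hk] at a1
    rw [div_lt_iff₀ hk] at a2
    rw [Real.norm_eq_abs, abs_le]
    constructor <;> simp only [Function.comp] <;> linarith
  refine (e1.smul hlim).congr fun k => ?_
  simp only [Function.comp]
  rw [smul_smul, mul_assoc, mul_inv_cancel₀ (hpos (i k)).ne', mul_one, Int.cast_smul_eq_zsmul]

theorem no_line (D : Dat K) (hε : 0 < ε) {v : EE d} (hv : ‖v‖ = 1)
    (hC : CC ε K (Set.range fun τ : ℝ => τ • v)) : False := by
  obtain ⟨Λ, S, r, hΛ, hS, -, hP⟩ := hC 0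
  have hgood : ∀ τ : ℝ, Good ε Λ (τ • v) := fun τ => by
    have := hP 0 D.h0 _ ⟨τ, rfl⟩
    rwa [map_zero, zero_add] at this
  obtain ⟨C, hC, hmah⟩ := mahlerW (d := d) 1 one_pos
  set C' := C + 1 with hC'
  have key : ∀ s : ℝ, 0 < s → ∃ w ∈ Λ, w ≠ 0 ∧
      s * ‖w.1 - (inner ℝ v w.1) • v‖ ≤ 2 * C' ∧ s * |w.2| ≤ C' := by
    intro s hs
    set κ : ℝ := (s ^ (d + 1))⁻¹ - 1 with hκ
    set f : WW d →L[ℝ] ℝ := κ • (innerSL ℝ v).comp (ContinuousLinearMap.fst ℝ (EE d) ℝ) with hf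
    set T : WW d →L[ℝ] WW d := s • (idW d + f.smulRight (v, (0 : ℝ))) with hT
    have hTdet : |T.det| = 1 := by
      have e1 : (T : WW d →ₗ[ℝ] WW d)
          = s • LinearMap.transvection (f : WW d →ₗ[ℝ] ℝ) (v, (0 : ℝ)) := by
        refine LinearMap.ext fun w => ?_
        simp [hT, LinearMap.transvection.apply]
      have e2 : f (v, (0 : ℝ)) = κ := by
        simp [hf, hv]
      rw [ContinuousLinearMap.det, e1, LinearMap.det_smul, LinearMap.transvection.det]
      have : Module.finrank ℝ (WW d) = d + 1 := by simp
      rw [this, ContinuousLinearMap.coe_coe, e2, hκ]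
      have : s ^ (d + 1) ≠ 0 := by positivity
      have : s ^ (d + 1) * (1 + ((s ^ (d + 1))⁻¹ - 1)) = 1 := by field_simp; ring
      rw [this, abs_one]
    have hex : ∃ u ∈ T '' Λ, u ≠ 0 ∧ ‖u‖ ≤ C' := by
      by_contra hcon
      push Not at hcon
      obtain ⟨g, hg1, hg2, hg3⟩ := hmah (T '' Λ) (hΛ.image hTdet) (fun w hw hw0 =>
        (by linarith : 1 ≤ C').trans (hcon w hw hw0).le)
      have hm : ((0 : EE d), (1 : ℝ)) ∈ ZZ d := by
        rw [mem_ZZ]; exact ⟨⟨0, by simp⟩, 1, by simp⟩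
      have h1 : g ((0 : EE d), (1 : ℝ)) ∈ T '' Λ := by rw [hg3]; exact ⟨_, hm, rfl⟩
      have h2 : g ((0 : EE d), (1 : ℝ)) ≠ 0 := by
        obtain ⟨g', -, hg'⟩ := exists_inverse hg1
        intro h
        have := hg' ((0 : EE d), (1 : ℝ))
        rw [h, map_zero] at this
        simpa using congrArg Prod.snd this
      have h3 := hcon _ h1 h2
      have h4 := g.le_opNorm ((0 : EE d), (1 : ℝ))
      have h5 : ‖((0 : EE d), (1 : ℝ))‖ = 1 := by simp [Prod.norm_mk]
      rw [h5, mul_one] at h4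
      linarith
    obtain ⟨_, ⟨w, hw, rfl⟩, hu0, hun⟩ := hex
    refine ⟨w, hw, fun h => hu0 (by rw [h, map_zero]), ?_, ?_⟩
    · set u1 : EE d := (T w).1 with hu1
      have e1 : u1 = s • (w.1 + (κ * inner ℝ v w.1) • v) := by
        simp [hu1, hT, hf]
      have e2 : s • (w.1 - (inner ℝ v w.1) • v) = u1 - (inner ℝ v u1) • v := by
        rw [e1, inner_smul_right, inner_add_right, inner_smul_right, real_inner_self_eq_norm_sq, hv]
        module
      have e3 : ‖u1‖ ≤ C' := (norm_fst_le _).trans hun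
      have e4 : s * ‖w.1 - (inner ℝ v w.1) • v‖ = ‖u1 - (inner ℝ v u1) • v‖ := by
        rw [← e2, norm_smul, Real.norm_of_nonneg hs.le]
      rw [e4]
      refine (norm_sub_le _ _).trans ?_
      have e5 : ‖(inner ℝ v u1 : ℝ) • v‖ ≤ ‖u1‖ := by
        rw [norm_smul, hv, mul_one]
        refine (norm_inner_le_norm _ _).trans ?_
        rw [hv, one_mul]
      linarith
    · have e1 : (T w).2 = s * w.2 := by simp [hT]
      have e2 : |(T w).2| ≤ C' := (norm_snd_le (T w)).trans hun
      rwa [e1, abs_mul, abs_of_pos hs] at e2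
  set M := 2 * C' with hM
  have hMpos : 0 < M := by positivity
  obtain ⟨n, hn⟩ := exists_nat_gt (M * (1 / ε + 1))
  have hMn : M < n := by
    refine lt_of_le_of_lt ?_ hn
    have : 0 ≤ M * (1 / ε) := by positivity
    linarith
  have hnpos : (0 : ℝ) < n := hMpos.trans hMn
  obtain ⟨w, hw, hw0, hw1, hw2⟩ := key n hnpos
  have hb : w.2 ≠ 0 := fun h => hw0 ((hgood 0).snd_ne hε w hw h)
  have h1 := hgood (inner ℝ v w.1 / w.2) w hw hw0
  have e1 : (sh ((inner ℝ v w.1 / w.2 : ℝ) • v) w) = (w.1 - (inner ℝ v w.1) • v, w.2) := by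
    rw [sh_apply, smul_smul, mul_div_cancel₀ _ hb]
  rw [e1, NN] at h1
  have h2 : ‖w.1 - (inner ℝ v w.1) • v‖ ≤ 1 := by
    have : n * ‖w.1 - (inner ℝ v w.1) • v‖ ≤ n * 1 := by linarith
    exact le_of_mul_le_mul_left this hnpos
  have h3 : ‖w.1 - (inner ℝ v w.1) • v‖ ^ d ≤ 1 := pow_le_one₀ (norm_nonneg _) h2
  have h4 : ε ≤ |w.2| := h1.trans (by
    simp only
    exact mul_le_of_le_one_left (abs_nonneg _) h3)
  have h5 : n * ε ≤ M := by
    calc n * ε ≤ n * |w.2| := by gcongr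
      _ ≤ C' := hw2
      _ ≤ M := by linarith
  have h6 : M * (1 / ε + 1) * ε = M + M * ε := by field_simp
  have h7 : M * (1 / ε + 1) * ε < n * ε := by gcongr
  have : 0 < M * ε := by positivity
  linarith

theorem no_CC (D : Dat K) (hε : 0 < ε) (hC : CC ε K {0}) : False := by
  obtain ⟨v, hv, h⟩ := line D hε hC
  exact no_line D hε hv h
end BAK

namespace BAK
variable {d : ℕ}

/-- affine similarities mapping `K` into itself -/
def Aff (K : Set (EE d)) (l : EE d →L[ℝ] EE d) (s : EE d) : Prop := ∀ z ∈ K, l z + s ∈ K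

theorem Aff.comp {K : Set (EE d)} {l l' : EE d →L[ℝ] EE d} {s s' : EE d} (h : Aff K l s)
    (h' : Aff K l' s') : Aff K (l.comp l') (l s' + s) := by
  intro z hz
  have := h _ (h' z hz)
  rw [map_add, add_assoc] at this
  exact this

theorem nonvanish {K : Set (EE d)} {B : ℝ} (hB : ∀ y ∈ K, ‖y‖ ≤ B) (h0 : (0 : EE d) ∈ K)
    {T : EE d →L[ℝ] EE d} {ρ : ℝ} (hT : IsSim T ρ) (hρ : ρ < 1) (hTK : ∀ y ∈ K, T y ∈ K)
    (hspan : Submodule.span ℝ {s | ∃ l r, IsSim l r ∧ Aff K l s} = ⊤)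
    (x : EE d) (M : EE d →L[ℝ] EE d) (y : EE d →L[ℝ] ℝ)
    (h : ∀ l r s, IsSim l r → Aff K l s → x + M s - (y s) • s = 0) : x = 0 ∧ M = 0 ∧ y = 0 := by
  have hx : x = 0 := by
    have := h (idE d) 1 0 isSim_one (fun z hz => by simpa using hz)
    simpa using this
  subst hx
  have hM : ∀ l r s, IsSim l r → Aff K l s → M s = (y s) • s := by
    intro l r s h1 h2
    have := h l r s h1 h2
    rw [zero_add] at this
    exact sub_eq_zero.1 this
  have hfin := Module.End.finite_hasEigenvalue M.toLinearMap
  obtain ⟨γ, hγ, hev⟩ : ∃ γ > 0, ∀ μ, Module.End.HasEigenvalue M.toLinearMap μ → |μ| < γ → μ = 0 := by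
    have h1 : ({μ | Module.End.HasEigenvalue M.toLinearMap μ} \ {0}).Finite := hfin.subset Set.sdiff_subset
    have h2 : ({μ | Module.End.HasEigenvalue M.toLinearMap μ} \ {0})ᶜ ∈ 𝓝 (0 : ℝ) :=
      h1.isClosed.isOpen_compl.mem_nhds (by simp)
    obtain ⟨γ, hγ, hsub⟩ := Metric.mem_nhds_iff.1 h2
    refine ⟨γ, hγ, fun μ hμ hlt => ?_⟩
    by_contra hne
    exact hsub (show μ ∈ ball 0 γ by simpa using hlt) ⟨hμ, hne⟩
  have hpow : ∀ k : ℕ, Aff K (T ^ k) 0 := by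
    intro k
    induction k with
    | zero => intro z hz; simpa using hz
    | succ k ih =>
      intro z hz
      rw [pow_succ]
      exact ih _ (hTK z hz)
  have hlim : Tendsto (fun k : ℕ => ‖y‖ * (ρ ^ k * B)) atTop (𝓝 (‖y‖ * (0 * B))) :=
    ((tendsto_pow_atTop_nhds_zero_of_lt_one hT.1.le hρ).mul_const B).const_mul _
  rw [zero_mul, mul_zero] at hlim
  obtain ⟨k, hk⟩ := (hlim.eventually (gt_mem_nhds hγ)).exists
  have hyk : y.comp (T ^ k) = 0 := by
    have hle : Submodule.span ℝ {s | ∃ l r, IsSim l r ∧ Aff K l s} ≤ LinearMap.ker (y.comp (T ^ k)).toLinearMap := by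
      rw [Submodule.span_le]
      rintro s ⟨l, r, hl, hs⟩
      rw [SetLike.mem_coe, LinearMap.mem_ker]
      change y ((T ^ k) s) = 0
      have hsB : ‖s‖ ≤ B := by
        have := hB _ (hs 0 h0)
        rwa [map_zero, zero_add] at this
      by_cases hs0 : (T ^ k) s = 0
      · rw [hs0, map_zero]
      · have e1 := hM _ _ _ ((hT.pow k).comp hl) ((hpow k).comp hs)
        rw [add_zero] at e1
        refine hev _ ?_ ?_
        · exact Module.End.hasEigenvalue_of_hasEigenvector
            (Module.End.hasEigenvector_iff.2 ⟨Module.End.mem_eigenspace_iff.2 e1, hs0⟩)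
        · refine lt_of_le_of_lt ((y.le_opNorm _).trans ?_) hk
          rw [(hT.pow k).2]
          have := (pow_pos hT.1 k).le
          gcongr
    rw [hspan, top_le_iff] at hle
    refine ContinuousLinearMap.ext fun v => ?_
    have : v ∈ LinearMap.ker (y.comp (T ^ k)).toLinearMap := by rw [hle]; trivial
    exact this
  have hy : y = 0 := by
    obtain ⟨T', -, hT', -⟩ := (hT.pow k).exists_inv
    refine ContinuousLinearMap.ext fun v => ?_
    have := congrArg (fun f : EE d →L[ℝ] ℝ => f (T' v)) hyk
    simpa [hT'] using this
  subst hy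
  refine ⟨rfl, ?_, rfl⟩
  have hle : Submodule.span ℝ {s | ∃ l r, IsSim l r ∧ Aff K l s} ≤ LinearMap.ker M.toLinearMap := by
    rw [Submodule.span_le]
    rintro s ⟨l, r, hl, hs⟩
    rw [SetLike.mem_coe, LinearMap.mem_ker]
    have := hM _ _ _ hl hs
    simpa using this
  rw [hspan, top_le_iff] at hle
  refine ContinuousLinearMap.ext fun v => ?_
  have : v ∈ LinearMap.ker M.toLinearMap := by rw [hle]; trivial
  exact this

theorem lemmaQ1 {K : Set (EE d)}
    (hnv : ∀ (x : EE d) (M : EE d →L[ℝ] EE d) (y : EE d →L[ℝ] ℝ),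
      (∀ l r s, IsSim l r → Aff K l s → x + M s - (y s) • s = 0) → x = 0 ∧ M = 0 ∧ y = 0) :
    ∃ c0 > 0, ∃ ρm > 0, ∀ (x : EE d) (M : EE d →L[ℝ] EE d) (y : EE d →L[ℝ] ℝ),
      ∃ l r s, IsSim l r ∧ Aff K l s ∧ ρm ≤ r ∧
        c0 * (‖x‖ + ‖M‖ + ‖y‖) ≤ ‖x + M s - (y s) • s‖ := by
  -- unit sphere version
  have key : ∃ n : ℕ, ∀ b : EE d × (EE d →L[ℝ] EE d) × (EE d →L[ℝ] ℝ), ‖b‖ = 1 →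
      ∃ l r s, IsSim l r ∧ Aff K l s ∧ 1 / ((n : ℝ) + 1) ≤ r ∧
        1 / ((n : ℝ) + 1) ≤ ‖b.1 + b.2.1 s - (b.2.2 s) • s‖ := by
    by_contra hcon
    push Not at hcon
    choose b hb1 hb2 using hcon
    obtain ⟨b', hb', ψ, hψ, hlim⟩ := (isCompact_sphere
      (0 : EE d × (EE d →L[ℝ] EE d) × (EE d →L[ℝ] ℝ)) 1).tendsto_subseq (x := b)
      (fun n => by simpa using hb1 n)
    have hz : Tendsto (fun n => 1 / (((ψ n : ℕ) : ℝ) + 1)) atTop (𝓝 0) :=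
      (tendsto_one_div_add_atTop_nhds_zero_nat (𝕜 := ℝ)).comp hψ.tendsto_atTop
    have h1 : ∀ l r s, IsSim l r → Aff K l s → b'.1 + b'.2.1 s - (b'.2.2 s) • s = 0 := by
      intro l r s hl hs
      have hcont : Continuous fun b : EE d × (EE d →L[ℝ] EE d) × (EE d →L[ℝ] ℝ) =>
          ‖b.1 + b.2.1 s - (b.2.2 s) • s‖ := by fun_prop
      have e1 := (hcont.tendsto b').comp hlim
      have e2 : ∀ᶠ n in atTop, ‖(b (ψ n)).1 + (b (ψ n)).2.1 s - ((b (ψ n)).2.2 s) • s‖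
          ≤ 1 / (((ψ n : ℕ) : ℝ) + 1) := by
        filter_upwards [hz.eventually (gt_mem_nhds hl.1)] with n hn
        exact (hb2 _ l r s hl hs hn.le).le
      have e3 := le_of_tendsto_of_tendsto e1 hz e2
      exact norm_le_zero_iff.1 e3
    obtain ⟨a1, a2, a3⟩ := hnv _ _ _ h1
    have : b' = 0 := Prod.ext a1 (Prod.ext a2 a3)
    rw [this] at hb'
    simp at hb'
  obtain ⟨n, hn⟩ := key
  have hnpos : (0 : ℝ) < 1 / ((n : ℝ) + 1) := by positivity
  refine ⟨1 / ((n : ℝ) + 1) / 3, by positivity, 1 / ((n : ℝ) + 1), hnpos, fun x M y => ?_⟩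
  by_cases hb0 : (x, M, y) = 0
  · obtain ⟨h1, h2⟩ := Prod.mk.inj hb0
    obtain ⟨h2, h3⟩ := Prod.mk.inj h2
    subst h1; subst h2; subst h3
    refine ⟨idE d, 1, 0, isSim_one, fun z hz => by simpa using hz, ?_, by simp⟩
    rw [div_le_one (by positivity)]
    have : (0 : ℝ) ≤ n := by positivity
    linarith
  · set N := ‖(x, M, y)‖ with hN
    have hNpos : 0 < N := norm_pos_iff.2 hb0
    obtain ⟨l, r, s, h1, h2, h3, h4⟩ := hn (N⁻¹ • (x, M, y)) (by
      rw [norm_smul, norm_inv, norm_norm, inv_mul_cancel₀ hNpos.ne'])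
    refine ⟨l, r, s, h1, h2, h3, ?_⟩
    have e1 : (N⁻¹ • (x, M, y)).1 + (N⁻¹ • (x, M, y)).2.1 s - ((N⁻¹ • (x, M, y)).2.2 s) • s
        = N⁻¹ • (x + M s - (y s) • s) := by
      simp [smul_smul, smul_sub]
    rw [e1, norm_smul, norm_inv, norm_norm, inv_mul_eq_div, le_div_iff₀ hNpos] at h4
    have n1 : ‖x‖ ≤ N := norm_fst_le (x, M, y)
    have n2 : ‖(M, y)‖ ≤ N := norm_snd_le (x, M, y)
    have n3 : ‖M‖ ≤ N := (norm_fst_le (M, y)).trans n2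
    have n4 : ‖y‖ ≤ N := (norm_snd_le (M, y)).trans n2
    refine le_trans ?_ h4
    have : ‖x‖ + ‖M‖ + ‖y‖ ≤ 3 * N := by linarith
    calc _ ≤ 1 / ((n : ℝ) + 1) / 3 * (3 * N) := by gcongr
      _ = _ := by ring

theorem lemmaQ {K : Set (EE d)}
    (hnv : ∀ (x : EE d) (M : EE d →L[ℝ] EE d) (y : EE d →L[ℝ] ℝ),
      (∀ l r s, IsSim l r → Aff K l s → x + M s - (y s) • s = 0) → x = 0 ∧ M = 0 ∧ y = 0) :
    ∃ c0 > 0, ∃ ρm > 0, ∀ (S : EE d →L[ℝ] EE d) (q : ℝ), IsSim S q →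
      ∀ (x : EE d) (M : EE d →L[ℝ] EE d)
      (y : EE d →L[ℝ] ℝ), ∃ (l : EE d →L[ℝ] EE d) (s : EE d) (ρσ : ℝ), IsSim l ρσ ∧ ρm ≤ ρσ ∧
      (∀ z ∈ K, l z + s ∈ K) ∧
      c0 * (‖x‖ + q * ‖M‖ + q ^ 2 * ‖y‖) ≤ ‖x + M (S s) - (y (S s)) • (S s)‖ := by
  obtain ⟨c0, hc0, ρm, hρm, h⟩ := lemmaQ1 hnv
  refine ⟨c0, hc0, ρm, hρm, fun S q hS x M y => ?_⟩
  obtain ⟨S', hS', hSS', hS'S⟩ := hS.exists_inv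
  have hq := hS.1
  obtain ⟨l, r, s, h1, h2, h3, h4⟩ := h (S' x) (S'.comp (M.comp S)) (y.comp S)
  refine ⟨l, s, r, h1, h3, h2, ?_⟩
  have e1 : S' x + (S'.comp (M.comp S)) s - ((y.comp S) s) • s
      = S' (x + M (S s) - (y (S s)) • (S s)) := by
    simp [hS'S]
  rw [e1, hS'.2, hS'.2] at h4
  have e2 : ‖M‖ ≤ ‖S'.comp (M.comp S)‖ := by
    refine ContinuousLinearMap.opNorm_le_bound _ (norm_nonneg _) fun v => ?_
    have a1 : M v = S ((S'.comp (M.comp S)) (S' v)) := by simp [hSS']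
    rw [a1, hS.2]
    have a2 := (S'.comp (M.comp S)).le_opNorm (S' v)
    rw [hS'.2] at a2
    calc _ ≤ q * (‖S'.comp (M.comp S)‖ * (q⁻¹ * ‖v‖)) := by gcongr
      _ = _ := by field_simp
  have e3 : q * ‖y‖ ≤ ‖y.comp S‖ := by
    rw [← le_div_iff₀' hq]
    refine ContinuousLinearMap.opNorm_le_bound _ (by positivity) fun v => ?_
    have a1 : y v = (y.comp S) (S' v) := by simp [hSS']
    have a2 := (y.comp S).le_opNorm (S' v)
    rw [hS'.2, ← a1] at a2
    refine a2.trans (le_of_eq ?_)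
    field_simp
  have e4 : q⁻¹ * ‖x + M (S s) - (y (S s)) • (S s)‖ ≥ c0 * (q⁻¹ * ‖x‖ + ‖M‖ + q * ‖y‖) :=
    le_trans (by gcongr) h4
  have e5 : q * (q⁻¹ * ‖x + M (S s) - (y (S s)) • (S s)‖) = ‖x + M (S s) - (y (S s)) • (S s)‖ := by
    field_simp
  rw [← e5]
  calc c0 * (‖x‖ + q * ‖M‖ + q ^ 2 * ‖y‖) = q * (c0 * (q⁻¹ * ‖x‖ + ‖M‖ + q * ‖y‖)) := by
        field_simp
    _ ≤ _ := by gcongr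

theorem mkDat (hd : 1 ≤ d) {E : Type*} {K : Set (EE d)} {B : ℝ} (hB : ∀ y ∈ K, ‖y‖ ≤ B)
    (h0 : (0 : EE d) ∈ K) (l : E → (EE d →L[ℝ] EE d)) (r : E → ℝ) (s : E → EE d)
    (hl : ∀ e, IsSim (l e) (r e)) (hr : ∀ e, r e < 1) (hK : ∀ e, Aff K (l e) (s e))
    (e0 : E) (he0 : s e0 = 0)
    (hirr : ∀ W : Submodule ℝ (EE d), (∀ e, ∀ x ∈ W, l e x + s e ∈ W) → W = ⊤) :
    Nonempty (Dat K) := by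
  have hTK : ∀ y ∈ K, l e0 y ∈ K := fun y hy => by
    have := hK e0 y hy
    rwa [he0, add_zero] at this
  set D0 : Set (EE d) := {s | ∃ l r, IsSim l r ∧ Aff K l s} with hD0
  have hspan : Submodule.span ℝ D0 = ⊤ := by
    apply hirr
    intro e x hx
    have hse : s e ∈ Submodule.span ℝ D0 := Submodule.subset_span ⟨l e, r e, hl e, hK e⟩
    refine Submodule.add_mem _ ?_ hse
    have hle : Submodule.span ℝ D0 ≤ (Submodule.span ℝ D0).comap (l e).toLinearMap := by
      rw [Submodule.span_le]
      rintro t ⟨l', r', hl', ht⟩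
      have h1 : l e t + s e ∈ Submodule.span ℝ D0 :=
        Submodule.subset_span ⟨_, _, (hl e).comp hl', (hK e).comp ht⟩
      have h2 := Submodule.sub_mem _ h1 hse
      rw [add_sub_cancel_right] at h2
      exact h2
    exact hle hx
  obtain ⟨c0, hc0, ρm, hρm, hQ⟩ := lemmaQ (nonvanish hB h0 (hl e0) (hr e0) hTK hspan)
  have hs1 : ∃ t ∈ D0, t ≠ 0 := by
    by_contra hcon
    push Not at hcon
    have h1 : Submodule.span ℝ D0 = ⊥ := by
      rw [Submodule.span_eq_bot]; exact hcon
    rw [hspan] at h1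
    have : Nontrivial (EE d) := by
      have : Nonempty (Fin d) := ⟨⟨0, hd⟩⟩
      infer_instance
    exact top_ne_bot h1
  obtain ⟨t, ⟨l1, r1, hl1, ht1⟩, ht0⟩ := hs1
  exact ⟨⟨l e0, r e0, hl e0, hr e0, hTK, h0, B, (norm_nonneg _).trans (hB 0 h0), hB,
    l1, r1, hl1, t, ht0, ht1, c0, hc0, ρm, hρm, hQ⟩⟩

/-- similarities are affine -/
theorem sim_affine {φ : EE d → EE d} {c : ℝ} (hc : 0 < c)
    (h : ∀ x y, dist (φ x) (φ y) = c * dist x y) :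
    ∃ l : EE d →L[ℝ] EE d, IsSim l c ∧ ∀ x y, φ x = l (x - y) + φ y := by
  have hiso : Isometry (fun x => c⁻¹ • φ x) := by
    refine Isometry.of_dist_eq fun x y => ?_
    rw [dist_smul₀, h, Real.norm_of_nonneg (inv_pos.2 hc).le, inv_mul_cancel_left₀ hc.ne']
  set f := hiso.affineIsometryOfStrictConvexSpace with hf
  have hfx : ∀ x, f x = c⁻¹ • φ x := fun x => rfl
  refine ⟨c • (f.linearIsometry.toContinuousLinearMap), ⟨hc, fun x => ?_⟩, fun x y => ?_⟩
  · rw [smul_apply, norm_smul, Real.norm_of_nonneg hc.le]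
    simp
  · have h1 := f.map_vadd y (x - y)
    rw [vadd_eq_add, sub_add_cancel, vadd_eq_add, hfx, hfx] at h1
    have h2 := congrArg (fun v => c • v) h1
    simp only [smul_add, smul_smul, mul_inv_cancel₀ hc.ne', one_smul] at h2
    exact h2
end BAK

namespace BAK
variable {d : ℕ}

theorem kap_mul_ge {r : ℝ} (hr : 0 < r) : kap d r * r = r ^ ((1 : ℝ) / (d + 1)) := by
  rw [kap]
  nth_rewrite 2 [← Real.rpow_one r]
  rw [← Real.rpow_add hr]
  congr 1
  have : (d + 1 : ℝ) ≠ 0 := by positivity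
  field_simp
  ring

theorem blowup {c : ℝ} (hc : 0 < c) {s : Set (EE d)}
    (hs : ∀ α ∈ s, ∀ w ∈ ZZ d, w.2 ≠ 0 → c ≤ NN (sh α w)) {x : EE d} (hx : x ∈ s)
    {K : Set (EE d)} {ρ : ℕ → ℝ} (hρ : ∀ n, 0 < ρ n) (hρ1 : ∀ n, ρ n ≤ 1)
    (hρ0 : Tendsto ρ atTop (𝓝 0)) {O : ℕ → (EE d →L[ℝ] EE d)} (hO : ∀ n, IsSim (O n) 1)
    {y : ℕ → EE d} {B : ℝ} (hy : ∀ n, ‖y n‖ ≤ B)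
    (H : ∀ z ∈ K, ∃ α : ℕ → EE d, (∀ n, α n ∈ s) ∧
      Tendsto (fun n => (ρ n)⁻¹ • (α n - x) - O n (z - y n)) atTop (𝓝 0)) :
    ∃ (Λ : Set (WW d)) (O' : EE d →L[ℝ] EE d) (y' : EE d), IsLat Λ ∧ IsSim O' 1 ∧
      ∀ z ∈ K, Good c Λ (O' (z - y')) := by
  set D : ℕ → (EE d →L[ℝ] EE d) := fun n => (ρ n)⁻¹ • ContinuousLinearMap.id ℝ (EE d) with hDdef
  have hD : ∀ n, IsSim (D n) (ρ n)⁻¹ := fun n => by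
    have := (isSim_one (d := d)).smul (inv_pos.2 (hρ n)); rwa [mul_one] at this
  set Λ : ℕ → Set (WW d) := fun n => HH (D n) (ρ n)⁻¹ '' (sh x '' (ZZ d : Set (WW d))) with hΛdef
  have hΛ : ∀ n, IsLat (Λ n) := fun n => by
    refine IsLat.image (IsLat.sh ⟨ContinuousLinearMap.id ℝ (WW d), ?_, ?_⟩ x) (HH_det (hD n))
    · simp [ContinuousLinearMap.det]
    · simp
  have key1 : ∀ n, ∀ α ∈ s, ∀ w ∈ Λ n, w.2 ≠ 0 → c ≤ NN (sh ((ρ n)⁻¹ • (α - x)) w) := by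
    rintro n α hα _ ⟨_, ⟨w, hw, rfl⟩, rfl⟩ h2
    have h2' : w.2 ≠ 0 := by
      intro h; apply h2; simp [h]
    have e : sh ((ρ n)⁻¹ • (α - x)) (HH (D n) (ρ n)⁻¹ (sh x w)) = HH (D n) (ρ n)⁻¹ (sh α w) := by
      simp only [sh_apply, HH_apply, hDdef, smul_apply, ContinuousLinearMap.id_apply, smul_smul,
        smul_sub, Prod.mk.injEq, and_true]
      simp only [mul_comm, mul_left_comm]
      abel
    rw [e, NN_HH (hD n)]
    exact hs α hα w hw h2'
  have key2 : ∀ n, ∀ w ∈ Λ n, w ≠ 0 → w.2 = 0 → (ρ n)⁻¹ ^ ((1 : ℝ) / (d + 1)) ≤ ‖w‖ := by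
    rintro n _ ⟨_, ⟨w, hw, rfl⟩, rfl⟩ hne h2
    have hk := kap_pos (d := d) (inv_pos.2 (hρ n))
    have h2' : w.2 = 0 := by
      simp only [sh_apply, HH_apply] at h2
      exact (mul_eq_zero.1 h2).resolve_left hk.ne'
    have hw1 : w.1 ≠ 0 := by
      intro h
      apply hne
      have : w = 0 := Prod.ext h h2'
      rw [this, map_zero, map_zero]
    have h1 : 1 ≤ ‖w.1‖ := by
      obtain ⟨⟨p, hp⟩, -⟩ := (mem_ZZ w).1 hw
      obtain ⟨i, hi⟩ : ∃ i, w.1 i ≠ 0 := by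
        by_contra h; push Not at h; exact hw1 (by ext i; simpa using h i)
      have : (1:ℝ) ≤ |w.1 i| := by
        rw [hp i] at hi ⊢
        have hpi : p i ≠ 0 := by
          intro h; rw [h] at hi; simp at hi
        rw [← Int.cast_abs]
        exact_mod_cast Int.one_le_abs hpi
      exact this.trans (by simpa using PiLp.norm_apply_le w.1 i)
    refine le_trans ?_ (norm_fst_le _)
    simp only [sh_apply, HH_apply, h2', zero_smul, sub_zero]
    rw [norm_smul, (hD n).2, Real.norm_of_nonneg hk.le, ← kap_mul_ge (inv_pos.2 (hρ n)), ← mul_assoc]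
    exact le_mul_of_one_le_right (mul_pos hk (inv_pos.2 (hρ n))).le h1
  have hge : ∀ n, ∀ w ∈ Λ n, w ≠ 0 → min c 1 ≤ ‖w‖ := by
    intro n w hw hne
    by_cases h2 : w.2 = 0
    · refine (min_le_right _ _).trans (le_trans ?_ (key2 n w hw hne h2))
      exact Real.one_le_rpow ((one_le_inv₀ (hρ n)).2 (hρ1 n)) (by positivity)
    · have h1 := key1 n x hx w hw h2
      have : Good c {w} 0 := by
        rintro _ rfl _
        simpa using h1
      exact this.norm_ge hc w rfl hne
  obtain ⟨C, hC, h⟩ := mahlerW (d := d) (min c 1) (lt_min hc one_pos)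
  choose g hg1 hg2 hg3 using fun k => h (Λ k) (hΛ k) (hge k)
  obtain ⟨⟨g', O', y'⟩, -, ψ, hψ, hlim⟩ := ((isCompact_closedBall (0 : WW d →L[ℝ] WW d) C).prod
    ((isCompact_closedBall (0 : EE d →L[ℝ] EE d) 1).prod
      (isCompact_closedBall (0 : EE d) B))).tendsto_subseq
    (x := fun k => (g k, O k, y k)) (fun k => ⟨by simpa using hg2 k,
      by simpa using (hO k).norm_le, by simpa using hy k⟩)
  have lg : Tendsto (fun k => g (ψ k)) atTop (𝓝 g') := (continuous_fst.tendsto _).comp hlim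
  have lO : Tendsto (fun k => O (ψ k)) atTop (𝓝 O') :=
    ((continuous_fst.comp continuous_snd).tendsto _).comp hlim
  have ly : Tendsto (fun k => y (ψ k)) atTop (𝓝 y') :=
    ((continuous_snd.comp continuous_snd).tendsto _).comp hlim
  refine ⟨g' '' (ZZ d : Set (WW d)), O', y', ⟨g', ?_, rfl⟩, ⟨one_pos, fun v => ?_⟩, ?_⟩
  · have hcont : Continuous fun f : WW d →L[ℝ] WW d => |f.det| :=
      ContinuousLinearMap.continuous_det.abs
    have h1 := (hcont.tendsto g').comp lg
    have h2 : ((fun f : WW d →L[ℝ] WW d => |f.det|) ∘ (fun k => g (ψ k))) = fun _ => (1 : ℝ) := by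
      ext k; simp [hg1]
    rw [h2] at h1
    exact (tendsto_nhds_unique h1 tendsto_const_nhds)
  · have h3 : Tendsto (fun k => ‖O (ψ k) v‖) atTop (𝓝 ‖O' v‖) :=
      (((ContinuousLinearMap.apply ℝ (EE d) v).continuous.tendsto O').comp lO).norm
    exact tendsto_nhds_unique h3 (tendsto_const_nhds.congr fun k => ((hO _).2 v).symm)
  · intro z hz
    obtain ⟨α, hα, hα0⟩ := H z hz
    have lOz : Tendsto (fun k => O (ψ k) (z - y (ψ k))) atTop (𝓝 (O' (z - y'))) :=
      (isBoundedBilinearMap_apply.continuous.tendsto (O', z - y')).comp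
        (lO.prodMk_nhds (tendsto_const_nhds.sub ly))
    have lu : Tendsto (fun k => (ρ (ψ k))⁻¹ • (α (ψ k) - x)) atTop (𝓝 (O' (z - y'))) := by
      have := (hα0.comp hψ.tendsto_atTop).add lOz
      rw [zero_add] at this
      refine this.congr fun k => ?_
      simp
    rintro _ ⟨m, hm, rfl⟩ hne
    have h1 : Tendsto (fun k => g (ψ k) m) atTop (𝓝 (g' m)) :=
      ((ContinuousLinearMap.apply ℝ (WW d) m).continuous.tendsto g').comp lg
    have h2 : ∀ᶠ k in atTop, g (ψ k) m ≠ 0 := h1.eventually_ne hne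
    have h3 : Tendsto (fun k => NN (sh ((ρ (ψ k))⁻¹ • (α (ψ k) - x)) (g (ψ k) m))) atTop
        (𝓝 (NN (sh (O' (z - y')) (g' m)))) := by
      apply (continuous_NN.tendsto _).comp
      simp only [sh_apply]
      have ha := (continuous_fst.tendsto _).comp h1
      have hb := (continuous_snd.tendsto _).comp h1
      exact (ha.sub (hb.smul lu)).prodMk_nhds hb
    have h4 : ∀ᶠ k in atTop, ‖g (ψ k) m‖ < ‖g' m‖ + 1 :=
      h1.norm.eventually_lt_const (by linarith)
    have h5 : Tendsto (fun k => (ρ (ψ k))⁻¹ ^ ((1 : ℝ) / (d + 1))) atTop atTop := by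
      apply (tendsto_rpow_atTop (by positivity)).comp
      apply Tendsto.comp tendsto_inv_nhdsGT_zero
      refine tendsto_nhdsWithin_iff.2 ⟨hρ0.comp hψ.tendsto_atTop, Eventually.of_forall fun k => hρ _⟩
    refine ge_of_tendsto h3 ?_
    filter_upwards [h2, h4, h5.eventually_ge_atTop (‖g' m‖ + 1)] with k hk hk4 hk5
    have hmem : g (ψ k) m ∈ Λ (ψ k) := by rw [hg3]; exact ⟨m, hm, rfl⟩
    refine key1 (ψ k) _ (hα _) _ hmem fun h0 => ?_
    have := key2 (ψ k) _ hmem hk h0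
    linarith
end BAK

namespace BAK
variable {d : ℕ}

def BAc (d : ℕ) (c : ℝ) : Set (EE d) :=
  {α | ∀ q : ℕ, 0 < q → ∀ p : Fin d → ℤ,
    c * (q : ℝ) ^ (-(1 : ℝ) / d) ≤
      ‖(q : ℝ) • α - (EuclideanSpace.equiv (Fin d) ℝ).symm (fun i => (p i : ℝ))‖}

theorem isClosed_BAc (c : ℝ) : IsClosed (BAc d c) := by
  have : BAc d c = ⋂ (q : ℕ) (_ : 0 < q) (p : Fin d → ℤ), {α : EE d | c * (q : ℝ) ^ (-(1 : ℝ) / d) ≤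
      ‖(q : ℝ) • α - (EuclideanSpace.equiv (Fin d) ℝ).symm (fun i => (p i : ℝ))‖} := by
    ext α; simp [BAc]
  rw [this]
  refine isClosed_iInter fun q => isClosed_iInter fun _ => isClosed_iInter fun p => ?_
  exact isClosed_le continuous_const (by fun_prop)

theorem BA_subset : badlyApproximable d ⊆ ⋃ n : ℕ, BAc d (1 / ((n : ℝ) + 1)) := by
  rintro α ⟨c, hc, h⟩
  obtain ⟨n, hn⟩ := exists_nat_one_div_lt hc
  refine Set.mem_iUnion.2 ⟨n, fun q hq p => le_trans ?_ (h q hq p)⟩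
  exact mul_le_mul_of_nonneg_right hn.le (by positivity)

theorem BAc_NN (hd : 1 ≤ d) {c : ℝ} (hc : 0 < c) {α : EE d} (hα : α ∈ BAc d c) :
    ∀ w ∈ ZZ d, w.2 ≠ 0 → c ^ d ≤ NN (sh α w) := by
  have pos : ∀ w : WW d, w ∈ ZZ d → 0 < w.2 → c ^ d ≤ NN (sh α w) := by
    intro w hw h2
    obtain ⟨⟨p, hp⟩, q, hq⟩ := (mem_ZZ w).1 hw
    have hq0 : 0 < q := by rw [hq] at h2; exact_mod_cast h2
    lift q to ℕ using hq0.le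
    have hq0' : 0 < q := by exact_mod_cast hq0
    have h := hα q hq0' p
    have e : (EuclideanSpace.equiv (Fin d) ℝ).symm (fun i => (p i : ℝ)) = w.1 := by
      ext i; simp [hp i]
    rw [e] at h
    have hqr : (0:ℝ) < q := by exact_mod_cast hq0'
    simp only [sh_apply, NN]
    rw [hq, norm_sub_rev]
    push_cast
    rw [abs_of_pos hqr]
    have hd0 : (d : ℝ) ≠ 0 := by positivity
    calc c ^ d = (c * (q : ℝ) ^ (-(1 : ℝ) / d)) ^ d * q := by
          rw [mul_pow, ← Real.rpow_natCast ((q : ℝ) ^ (-(1 : ℝ) / d)), ← Real.rpow_mul hqr.le,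
            div_mul_cancel₀ _ hd0, Real.rpow_neg_one, mul_assoc, inv_mul_cancel₀ hqr.ne', mul_one]
      _ ≤ _ := by gcongr
  intro w hw h2
  rcases lt_or_gt_of_ne h2 with h | h
  · have := pos (-w) ((ZZ d).neg_mem hw) (by simpa using h)
    rw [map_neg] at this
    simpa only [NN, Prod.fst_neg, Prod.snd_neg, norm_neg, abs_neg] using this
  · exact pos w hw h

theorem doubling_iter {ν : Measure (EE d)} {C : ℝ≥0}
    (h : ∀ x ∈ measSupport ν, ∀ r : ℝ, 0 < r → r ≤ 1 → ν (ball x (2 * r)) ≤ C * ν (ball x r))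
    {x : EE d} (hx : x ∈ measSupport ν) (m : ℕ) {r : ℝ} (hr : 0 < r) (hr1 : 2 ^ m * r ≤ 1) :
    ν (ball x (2 ^ m * r)) ≤ (C : ℝ≥0∞) ^ m * ν (ball x r) := by
  induction m with
  | zero => simp
  | succ m ih =>
    have h0 : 0 < 2 ^ m * r := by positivity
    have h1 : 2 ^ m * r ≤ 1 := by rw [pow_succ] at hr1; nlinarith
    calc ν (ball x (2 ^ (m + 1) * r)) = ν (ball x (2 * (2 ^ m * r))) := by
          congr 2; ring
      _ ≤ C * ν (ball x (2 ^ m * r)) := h x hx _ h0 h1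
      _ ≤ C * ((C : ℝ≥0∞) ^ m * ν (ball x r)) := by gcongr; exact ih h1
      _ = _ := by rw [pow_succ]; ring

theorem measure_compl_supp (ν : Measure (EE d)) : ν (measSupport ν)ᶜ = 0 := by
  refine measure_null_of_locally_null _ fun x hx => ?_
  simp only [measSupport, Set.mem_compl_iff, Set.mem_ofPred_eq] at hx
  push Not at hx
  obtain ⟨ε, hε, h⟩ := hx
  exact ⟨ball x ε, mem_nhdsWithin_of_mem_nhds (ball_mem_nhds x hε), h⟩

theorem density {ν : Measure (EE d)} [IsLocallyFiniteMeasure ν] {C : ℝ≥0}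
    (hdb : ∀ x ∈ measSupport ν, ∀ r : ℝ, 0 < r → r ≤ 1 → ν (ball x (2 * r)) ≤ C * ν (ball x r))
    {s : Set (EE d)} {x : EE d}
    (hlim : Tendsto (fun r => ν (s ∩ closedBall x r) / ν (closedBall x r)) (𝓝[>] 0) (𝓝 1))
    {R η : ℝ} (hR : 0 ≤ R) (hη : 0 < η) :
    ∃ r0 > 0, ∀ r, 0 < r → r < r0 → ∀ y ∈ measSupport ν, dist y x ≤ R * r →
      ∃ α ∈ s, dist y α ≤ η * r := by
  obtain ⟨m, hm⟩ := pow_unbounded_of_one_lt (2 * (R + η) / η) (one_lt_two : (1:ℝ) < 2)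
  rw [div_lt_iff₀ hη] at hm
  set q : ℝ≥0∞ := 1 - ((C : ℝ≥0∞) ^ m)⁻¹ with hq
  have hCm : (C : ℝ≥0∞) ^ m ≠ ⊤ := by finiteness
  have hq1 : q < 1 := ENNReal.sub_lt_self ENNReal.one_ne_top one_ne_zero (by
    rw [ne_eq, ENNReal.inv_eq_zero]; exact hCm)
  have hev := hlim.eventually (lt_mem_nhds hq1)
  rw [eventually_nhdsWithin_iff, Metric.eventually_nhds_iff] at hev
  obtain ⟨δ, hδ, hev⟩ := hev
  refine ⟨min (δ / (R + η)) (1 / (2 ^ m * η)), by positivity, fun r hr hr0 y hy hyx => ?_⟩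
  by_contra hcon
  push Not at hcon
  have hRη : 0 < R + η := by positivity
  have hr1 : (R + η) * r < δ := by
    have := hr0.trans_le (min_le_left _ _)
    rw [lt_div_iff₀ hRη] at this; linarith
  have hr2 : 2 ^ m * (η * r) ≤ 1 := by
    have := hr0.trans_le (min_le_right _ _)
    rw [lt_div_iff₀ (by positivity)] at this; nlinarith
  set ρ := (R + η) * r with hρ
  have hρ0 : 0 < ρ := by positivity
  have h1 := hev (y := ρ) (by rw [Real.dist_eq, sub_zero, abs_of_pos hρ0]; exact hr1) hρ0
  have hsub1 : ball y (η * r) ⊆ closedBall x ρ := by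
    intro z hz
    have hz' : dist z y < η * r := hz
    have := dist_triangle z y x
    simp only [mem_closedBall]
    rw [hρ]; linarith
  have hdisj : Disjoint (s ∩ closedBall x ρ) (ball y (η * r)) := by
    rw [Set.disjoint_left]
    rintro z ⟨hz, -⟩ hz2
    have := hcon z hz
    rw [mem_ball, dist_comm] at hz2
    linarith
  have hsub2 : closedBall x ρ ⊆ ball y (2 ^ m * (η * r)) := by
    intro z hz
    have hz' : dist z x ≤ ρ := hz
    have := dist_triangle z x y
    rw [dist_comm x y] at this
    rw [mem_ball]
    have h3 : 2 * (R + η) * r < 2 ^ m * η * r := mul_lt_mul_of_pos_right hm hr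
    rw [hρ] at hz'
    nlinarith
  have hA : ν (closedBall x ρ) ≤ (C : ℝ≥0∞) ^ m * ν (ball y (η * r)) :=
    (measure_mono hsub2).trans (doubling_iter hdb hy m (by positivity) hr2)
  have hB : ν (s ∩ closedBall x ρ) + ν (ball y (η * r)) ≤ ν (closedBall x ρ) := by
    rw [← measure_union hdisj measurableSet_ball]
    exact measure_mono (Set.union_subset Set.inter_subset_right hsub1)
  have hby : ν (ball y (η * r)) ≠ 0 := hy _ (by positivity)
  have hN0 : ν (closedBall x ρ) ≠ 0 := fun h => hby (measure_mono_null hsub1 h)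
  have hNt : ν (closedBall x ρ) ≠ ⊤ := (isCompact_closedBall x ρ).measure_lt_top.ne
  have hb : ((C : ℝ≥0∞) ^ m)⁻¹ * ν (closedBall x ρ) ≤ ν (ball y (η * r)) := by
    rw [mul_comm, ← div_eq_mul_inv]
    refine ENNReal.div_le_of_le_mul ?_
    rw [mul_comm]; exact hA
  refine absurd h1 (not_lt.2 ?_)
  refine ENNReal.div_le_of_le_mul ?_
  rw [hq, ENNReal.sub_mul (fun _ _ => hNt), one_mul]
  refine ENNReal.le_sub_of_add_le_right (ENNReal.mul_ne_top ?_ hNt) ?_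
  · intro h
    rw [h, ENNReal.top_mul hN0] at hb
    have := (measure_mono hsub1).trans_lt (lt_top_iff_ne_top.2 hNt)
    exact absurd hb (not_le.2 this)
  · exact (add_le_add_right hb _).trans hB
end BAK

namespace BAK
variable {d : ℕ}

def scons {E : Type*} (e : E) (b : ℕ → E) : ℕ → E
  | 0 => e
  | n + 1 => b n

theorem seqApply_scons {E X : Type*} (φ : E → X → X) (e : E) (b : ℕ → E) (n : ℕ) (x : X) :
    seqApply φ (scons e b) (n + 1) x = φ e (seqApply φ b n x) := by
  induction n generalizing x with
  | zero => rfl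
  | succ n ih =>
    change seqApply φ (scons e b) (n + 1) (φ (b n) x) = φ e (seqApply φ b n (φ (b n) x))
    exact ih _

theorem lin_seq {E : Type*} {φ : E → EE d → EE d} {l : E → (EE d →L[ℝ] EE d)} {c : E → ℝ}
    (hl : ∀ e, IsSim (l e) (c e)) (hφ : ∀ e x y, φ e x = l e (x - y) + φ e y) (b : ℕ → E) (n : ℕ) :
    ∃ L : EE d →L[ℝ] EE d, IsSim L (∏ i ∈ Finset.range n, c (b i)) ∧
      ∀ x y, seqApply φ b n x = L (x - y) + seqApply φ b n y := by
  induction n with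
  | zero => exact ⟨ContinuousLinearMap.id ℝ _, by simpa using isSim_one, fun x y => by simp [seqApply]⟩
  | succ n ih =>
    obtain ⟨L, hL, h⟩ := ih
    refine ⟨L.comp (l (b n)), ?_, fun x y => ?_⟩
    · rw [Finset.prod_range_succ]; exact hL.comp (hl _)
    · change seqApply φ b n (φ (b n) x) = _ + seqApply φ b n (φ (b n) y)
      rw [h _ (φ (b n) y), hφ (b n) x y, add_sub_cancel_right]; rfl

theorem main_aux
    (d : ℕ) (hd : 1 ≤ d) {E : Type*} [Fintype E] [Nonempty E]
    (φ : E → EE d → EE d)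
    (hsim : ∀ e, ContractingSimilarity (φ e))
    (hirr : IrreducibleIFS φ)
    (π : (ℕ → E) → EE d)
    (hπ : ∀ (b : ℕ → E) (x₀ : EE d), Tendsto (fun n => seqApply φ b n x₀) atTop (𝓝 (π b)))
    (ν : Measure (EE d)) [IsLocallyFiniteMeasure ν]
    (hdbl : IsDoubling ν) (hsupp : measSupport ν = Set.range π) :
    ν (badlyApproximable d) = 0 := by
  choose c hc0 hc1 hc using hsim
  choose l hl hφ using fun e => sim_affine (hc0 e) (hc e)
  have hcont : ∀ e, Continuous (φ e) := fun e => by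
    have : φ e = fun x => l e (x - 0) + φ e 0 := funext fun x => hφ e x 0
    rw [this]; fun_prop
  -- IFS facts
  have hcons : ∀ e b, φ e (π b) = π (scons e b) := fun e b => by
    have h1 := ((hcont e).tendsto _).comp (hπ b 0)
    have h2 := (hπ (scons e b) 0).comp (tendsto_add_atTop_nat 1)
    refine tendsto_nhds_unique h1 (h2.congr fun n => ?_)
    exact seqApply_scons φ e b n 0
  have hshift : ∀ b n, seqApply φ b n (π (fun i => b (i + n))) = π b := by
    intro b n
    induction n with
    | zero => rfl
    | succ n ih =>
      change seqApply φ b n (φ (b n) _) = _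
      rw [hcons, ← ih]
      congr 2
      funext i
      cases i with
      | zero => simp [scons]
      | succ i => simp only [scons]; congr 1; ring
  obtain ⟨em, hem⟩ := Finite.exists_max c
  obtain ⟨eM, heM⟩ := Finite.exists_max (fun e => ‖φ e 0‖)
  have h1m : 0 < 1 - c em := by linarith [hc1 em]
  set B := ‖φ eM 0‖ / (1 - c em) with hB
  have hB0 : 0 ≤ B := by positivity
  have hBinv : ∀ e v, ‖v‖ ≤ B → ‖φ e v‖ ≤ B := fun e v hv => by
    rw [hφ e v 0, sub_zero]
    refine (norm_add_le _ _).trans ?_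
    rw [(hl e).2]
    have h1 : c e * ‖v‖ ≤ c em * B := mul_le_mul (hem e) hv (norm_nonneg _) (hc0 _).le
    have h2 := heM e
    have h3 : B * (1 - c em) = ‖φ eM 0‖ := div_mul_cancel₀ _ h1m.ne'
    nlinarith
  have hBseq : ∀ b n v, ‖v‖ ≤ B → ‖seqApply φ b n v‖ ≤ B := by
    intro b n
    induction n with
    | zero => exact fun v hv => hv
    | succ n ih => exact fun v hv => ih _ (hBinv _ _ hv)
  have hKB : ∀ b, ‖π b‖ ≤ B := fun b =>
    le_of_tendsto (hπ b 0).norm (Eventually.of_forall fun n => hBseq b n 0 (by simpa using hB0))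
  -- the translated limit set
  obtain ⟨e0⟩ := ‹Nonempty E›
  set x0 := π (fun _ => e0) with hx0
  have hfix : φ e0 x0 = x0 := by
    rw [hx0, hcons]
    congr 1
    funext i
    cases i <;> rfl
  set K' : Set (EE d) := {z | z + x0 ∈ Set.range π} with hK'
  have hdat : Nonempty (Dat K') := by
    refine mkDat hd (B := B + ‖x0‖) ?_ ?_ l c (fun e => φ e x0 - x0) hl hc1 ?_ e0 ?_ ?_
    · rintro y ⟨b, hb⟩
      have : y = π b - x0 := by rw [hb]; abel
      rw [this]
      exact (norm_sub_le _ _).trans (by linarith [hKB b])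
    · exact ⟨_, by rw [zero_add, hx0]⟩
    · rintro e z ⟨b, hb⟩
      refine ⟨scons e b, ?_⟩
      rw [← hcons, hb, hφ e _ x0]
      simp only [add_sub_cancel_right]; abel
    · simp [hfix]
    · intro W hW
      by_contra hne
      apply hirr
      have hs : ∀ e, φ e x0 - x0 ∈ W := fun e => by
        have := hW e 0 W.zero_mem
        rwa [map_zero, zero_add] at this
      have hlW : ∀ e, ∀ v ∈ W, l e v ∈ W := fun e v hv => by
        have := W.sub_mem (hW e v hv) (hs e)
        rwa [add_sub_cancel_right] at this
      have hinj : ∀ e, Function.Injective (l e) := fun e => by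
        obtain ⟨S', -, -, h2⟩ := (hl e).exists_inv
        exact Function.LeftInverse.injective h2
      have hsurj : ∀ e, ∀ v ∈ W, ∃ u ∈ W, l e u = v := fun e v hv => by
        let f : W →ₗ[ℝ] W := (l e : EE d →ₗ[ℝ] EE d).restrict (hlW e)
        have hf : Function.Injective f := fun a b hab => by
          apply Subtype.ext
          apply hinj e
          exact congrArg Subtype.val hab
        obtain ⟨u, hu⟩ := (LinearMap.injective_iff_surjective.1 hf) ⟨v, hv⟩
        exact ⟨u, u.2, congrArg Subtype.val hu⟩
      refine ⟨AffineSubspace.mk' x0 W, ⟨x0, AffineSubspace.self_mem_mk' _ _⟩, ?_, fun e => ?_⟩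
      · intro h
        apply hne
        have := congrArg AffineSubspace.direction h
        rwa [AffineSubspace.direction_mk', AffineSubspace.direction_top] at this
      · ext z
        simp only [Set.mem_image, SetLike.mem_coe, AffineSubspace.mem_mk', vsub_eq_sub]
        constructor
        · rintro ⟨y, hy, rfl⟩
          rw [hφ e y x0, add_sub_assoc]
          exact hW e _ hy
        · intro hz
          obtain ⟨u, hu, hlu⟩ := hsurj e (z - φ e x0) (by
            have := W.sub_mem hz (hs e)
            rwa [sub_sub_sub_cancel_right] at this)
          refine ⟨u + x0, by simpa using hu, ?_⟩
          rw [hφ e _ x0, add_sub_cancel_right, hlu]; abel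
  obtain ⟨D⟩ := hdat
  by_contra hBA
  -- choose a density point
  obtain ⟨n0, hn0⟩ : ∃ n : ℕ, ν (BAc d (1 / ((n : ℝ) + 1))) ≠ 0 := by
    by_contra h
    push Not at h
    exact hBA (measure_mono_null BA_subset (measure_iUnion_null h))
  set c' : ℝ := 1 / ((n0 : ℝ) + 1) with hc'
  have hc'0 : 0 < c' := by positivity
  set s := BAc d c' with hs
  have hscl : IsClosed s := isClosed_BAc c'
  obtain ⟨C, -, hdb⟩ := hdbl
  obtain ⟨x, ⟨hxs, hxK⟩, hlim⟩ : ∃ x, (x ∈ s ∧ x ∈ measSupport ν) ∧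
      Tendsto (fun r => ν (s ∩ closedBall x r) / ν (closedBall x r)) (𝓝[>] 0) (𝓝 1) := by
    have h1 := Besicovitch.ae_tendsto_measure_inter_div ν s
    have h2 : ∀ᵐ x ∂ν.restrict s, x ∈ s := ae_restrict_mem hscl.measurableSet
    have h3 : ∀ᵐ x ∂ν.restrict s, x ∈ measSupport ν :=
      ae_restrict_of_ae (measure_compl_supp ν)
    have : (ae (ν.restrict s)).NeBot := by
      rw [ae_neBot]
      rwa [ne_eq, Measure.restrict_eq_zero]
    obtain ⟨x, hx⟩ := (h2.and (h3.and h1)).exists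
    exact ⟨x, ⟨hx.1, hx.2.1⟩, hx.2.2⟩
  obtain ⟨b, hb⟩ : x ∈ Set.range π := by rw [← hsupp]; exact hxK
  choose L hL hLf using fun n => lin_seq hl hφ b n
  set ρ : ℕ → ℝ := fun n => ∏ i ∈ Finset.range n, c (b i) with hρdef
  have hρ : ∀ n, 0 < ρ n := fun n => Finset.prod_pos fun i _ => hc0 _
  have hρ1 : ∀ n, ρ n ≤ 1 := fun n => Finset.prod_le_one (fun i _ => (hc0 _).le) fun i _ => (hc1 _).le
  have hρ0 : Tendsto ρ atTop (𝓝 0) := by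
    refine squeeze_zero (fun n => (hρ n).le) (fun n => ?_)
      (tendsto_pow_atTop_nhds_zero_of_lt_one (hc0 em).le (hc1 em))
    calc ρ n ≤ ∏ i ∈ Finset.range n, c em :=
          Finset.prod_le_prod (fun i _ => (hc0 _).le) fun i _ => hem _
      _ = _ := by simp
  set y : ℕ → EE d := fun n => π (fun i => b (i + n)) with hy
  have hf : ∀ n z, seqApply φ b n z = L n (z - y n) + x := fun n z => by
    rw [hLf n z (y n), hy, hshift, hb]
  have hmapK : ∀ n z, z ∈ Set.range π → seqApply φ b n z ∈ Set.range π := by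
    intro n
    induction n with
    | zero => exact fun z hz => hz
    | succ n ih =>
      rintro _ ⟨b', rfl⟩
      refine ih _ ⟨_, (hcons (b n) b').symm⟩
  have hO : ∀ n, IsSim ((ρ n)⁻¹ • L n) 1 := fun n => by
    have := (hL n).smul (inv_pos.2 (hρ n))
    rwa [inv_mul_cancel₀ (hρ n).ne'] at this
  obtain ⟨Λ, O', y', hΛ, hO', hgood⟩ := blowup (c := c' ^ d) (by positivity)
    (fun α hα => BAc_NN hd hc'0 hα) hxs (K := Set.range π) hρ hρ1 hρ0 hO (y := y) (B := B)
    (fun n => hKB _) (by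
      intro z hz
      choose α hα hαd using fun n =>
        hscl.exists_infDist_eq_dist ⟨x, hxs⟩ (seqApply φ b n z)
      refine ⟨α, hα, ?_⟩
      rw [Metric.tendsto_atTop]
      intro ε hε
      obtain ⟨r0, hr0, hden⟩ := density hdb hlim (R := 2 * B) (η := ε / 2)
        (by positivity) (by positivity)
      obtain ⟨N, hN⟩ := eventually_atTop.1 (hρ0.eventually (gt_mem_nhds hr0))
      refine ⟨N, fun n hn => ?_⟩
      obtain ⟨α', hα', hd'⟩ := hden (ρ n) (hρ n) (hN n hn) (seqApply φ b n z)
        (by rw [hsupp]; exact hmapK n z hz) (by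
          rw [hf, dist_eq_norm, add_sub_cancel_right, (hL n).2, mul_comm]
          have h1 : ‖z - y n‖ ≤ 2 * B := by
            obtain ⟨bz, rfl⟩ := hz
            exact (norm_sub_le _ _).trans (by linarith [hKB bz, hKB (fun i => b (i + n))])
          exact mul_le_mul_of_nonneg_right h1 (hρ n).le)
      have h1 : dist (seqApply φ b n z) (α n) ≤ ε / 2 * ρ n := by
        rw [← hαd]; exact (infDist_le_dist_of_mem hα').trans hd'
      have e : (ρ n)⁻¹ • (α n - x) - ((ρ n)⁻¹ • L n) (z - y n)
          = (ρ n)⁻¹ • (α n - seqApply φ b n z) := by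
        rw [hf, smul_apply, ← smul_sub]; congr 1; abel
      rw [e, dist_zero_right, norm_smul, Real.norm_of_nonneg (inv_pos.2 (hρ n)).le,
        ← dist_eq_norm, dist_comm]
      rw [inv_mul_lt_iff₀ (hρ n)]
      nlinarith [hρ n])
  refine no_CC D (ε := c' ^ d) (by positivity) ?_
  intro R
  have hR' : 0 < max R 1 := lt_max_of_lt_right one_pos
  have hS0 : IsSim (max R 1 • ContinuousLinearMap.id ℝ (EE d)) (max R 1) := by
    have := (isSim_one (d := d)).smul hR'; rwa [mul_one] at this
  refine ⟨HH (max R 1 • ContinuousLinearMap.id ℝ (EE d)) (max R 1) '' (sh (O' (x0 - y')) '' Λ),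
    max R 1 • O', max R 1, (hΛ.sh _).image (HH_det hS0), ?_, le_max_left _ _, ?_⟩
  · have := hO'.smul hR'; rwa [mul_one] at this
  · intro z hz a ha
    rw [Set.mem_singleton_iff.1 ha, add_zero]
    have h1 := hgood _ hz
    have h2 : Good (c' ^ d) (sh (O' (x0 - y')) '' Λ) (O' z) := by
      rw [good_sh, ← map_add]
      convert h1 using 2
      abel
    exact good_HH hS0 h2
end BAK

/-- **Theorem.** Let `K ⊆ ℝ^d` be the limit set of an irreducible finite similarity IFS
satisfying the open set condition.  If `ν` is a doubling locally finite Borel measure on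
`ℝ^d` with `supp ν = K`, then `ν(BA) = 0`. -/
theorem doubling_measure_badlyApproximable_eq_zero
    (d : ℕ) (hd : 1 ≤ d) {E : Type*} [Fintype E] [Nonempty E]
    (φ : E → EuclideanSpace ℝ (Fin d) → EuclideanSpace ℝ (Fin d))
    (hsim : ∀ e, ContractingSimilarity (φ e))
    (hirr : IrreducibleIFS φ)
    (hosc : OpenSetCondition φ)
    (π : (ℕ → E) → EuclideanSpace ℝ (Fin d))
    (hπ : ∀ (b : ℕ → E) (x₀ : EuclideanSpace ℝ (Fin d)),
      Tendsto (fun n => seqApply φ b n x₀) atTop (𝓝 (π b)))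
    (K : Set (EuclideanSpace ℝ (Fin d))) (hK : K = Set.range π)
    (ν : Measure (EuclideanSpace ℝ (Fin d))) [IsLocallyFiniteMeasure ν]
    (hdbl : IsDoubling ν)
    (hsupp : measSupport ν = K) :
    ν (badlyApproximable d) = 0 := by
  rw [hK] at hsupp
  exact BAK.main_aux d hd φ hsim hirr π hπ ν hdbl hsupp
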